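/- arXiv:1712.01459 — 3 statements merged into one kernel-verified Lean document; each statement's English description precedes it below -/
import Mathlib

section
/- Let Y₁, Y₂ be independent random variables with non-lattice distributions V₁, V₂ satisfying V̄ᵢ(x) ∼ e^{−αx} fᵢ(x), where α > 0, fᵢ = lᵢ∘exp with lᵢ slowly varying, fᵢ locally bounded, and ∫₀^∞ fᵢ(y) dy = ∞ (i.e., Vᵢ ∈ 𝓛₁(α)). Then P(Y₁+Y₂ > x) ∼ α e^{−αx} ∫₀ˣ f₁(x−y) f₂(y) dy as x → ∞, and in particular V₁∗V₂ ∈ 𝓛₁(α). -/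
open Filter MeasureTheory Asymptotics

/-- A measure on `ℝ` is lattice if it is concentrated on `{a + n d : n ∈ ℤ}`
for some `d > 0`. -/
def IsLatticeMeasure (μ : Measure ℝ) : Prop :=
  ∃ a d : ℝ, 0 < d ∧ μ (Set.range fun n : ℤ => a + n * d) = 1

/-- The distribution (measure) `μ` belongs to the class `𝓛₁(α)`: its tail satisfies
`μ(x,∞) ∼ e^{-αx} f(x)` with `f = l ∘ exp`, `l` slowly varying, `f` locally bounded
and `∫₀^∞ f = ∞`. -/
def MemL1 (μ : Measure ℝ) (α : ℝ) : Prop :=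
  ∃ f l : ℝ → ℝ,
    (∀ t : ℝ, 0 < t → Tendsto (fun x => l (x * t) / l x) atTop (nhds 1)) ∧
    (∀ x, f x = l (Real.exp x)) ∧ (∀ x, 0 ≤ f x) ∧
    (∀ r : ℝ, ∃ C : ℝ, ∀ x ∈ Set.Icc (0:ℝ) r, f x ≤ C) ∧
    ((fun x => (μ (Set.Ioi x)).toReal) ~[atTop] (fun x => Real.exp (-α * x) * f x)) ∧
    Tendsto (fun x => ∫ y in (0:ℝ)..x, f y) atTop atTop

open Set Topology

/-- The tail `x ↦ μ(x, ∞)`. -/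
noncomputable def rightTail (μ : Measure ℝ) (x : ℝ) : ℝ := μ.real (Ioi x)

/-- The tail of the convolution of `μ` and `ν`. -/
noncomputable def sumTail (μ ν : Measure ℝ) (x : ℝ) : ℝ :=
  (μ.prod ν).real {p : ℝ × ℝ | x < p.1 + p.2}

/-- The convolution of `a` and `b` over the half-line. -/
noncomputable def halfConv (a b : ℝ → ℝ) (x : ℝ) : ℝ := ∫ y in (0 : ℝ)..x, a (x - y) * b y

/-- Membership of `μ` in the exponential class `𝓛(α)`. -/
def HasExpTail (μ : Measure ℝ) (α : ℝ) : Prop :=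
  ∀ s, Tendsto (fun x => rightTail μ (x + s) / rightTail μ x) atTop (𝓝 (Real.exp (-α * s)))

/-- Integrability and boundedness on the intervals `[0, r]`. -/
def LocBdd (a : ℝ → ℝ) : Prop :=
  ∀ r, 0 ≤ r → IntervalIntegrable a volume 0 r ∧ ∃ C, ∀ x ∈ Icc 0 r, |a x| ≤ C

namespace LocBdd

variable {a b : ℝ → ℝ}

theorem sub (ha : LocBdd a) (hb : LocBdd b) : LocBdd (fun x => a x - b x) := by
  intro r hr
  obtain ⟨h1, C, hC⟩ := ha r hr
  obtain ⟨h2, D, hD⟩ := hb r hr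
  exact ⟨h1.sub h2, C + D, fun x hx => (abs_sub _ _).trans (add_le_add (hC x hx) (hD x hx))⟩

theorem mul_continuous (ha : LocBdd a) (hb : Continuous b) : LocBdd (fun x => a x * b x) := by
  intro r hr
  obtain ⟨h1, C, hC⟩ := ha r hr
  obtain ⟨D, hD⟩ := isCompact_Icc.exists_bound_of_continuousOn (hb.continuousOn (s := Icc 0 r))
  refine ⟨h1.mul_continuousOn hb.continuousOn, C * D, fun x hx => ?_⟩
  rw [abs_mul]
  exact mul_le_mul (hC x hx) (hD x hx) (abs_nonneg _) ((abs_nonneg _).trans (hC x hx))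

theorem of_antitone (ha : Antitone a) : LocBdd a := by
  refine fun r _ => ⟨ha.intervalIntegrable, |a 0| + |a r|, fun x hx => ?_⟩
  have h1 := ha hx.1
  have h2 := ha hx.2
  rw [abs_le]
  constructor <;> linarith [le_abs_self (a 0), neg_abs_le (a r), abs_nonneg (a 0), abs_nonneg (a r)]

theorem intervalIntegrable_conv (ha : LocBdd a) (hb : LocBdd b) {x : ℝ} (hx : 0 ≤ x) :
    IntervalIntegrable (fun y => a (x - y) * b y) volume 0 x := by
  obtain ⟨h1, C, hC⟩ := ha x hx
  obtain ⟨h2, -⟩ := hb x hx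
  have h3 : IntervalIntegrable (fun y => a (x - y)) volume 0 x := by
    have := h1.comp_sub_left x
    simpa using this.symm
  rw [intervalIntegrable_iff_integrableOn_Ioc_of_le hx] at h2 h3 ⊢
  refine Integrable.bdd_mul (c := C) h2 h3.aestronglyMeasurable ?_
  filter_upwards [ae_restrict_mem measurableSet_Ioc] with y hy
  exact hC _ ⟨by linarith [hy.2], by linarith [hy.1]⟩

end LocBdd

theorem halfConv_comm (a b : ℝ → ℝ) (x : ℝ) : halfConv a b x = halfConv b a x := by
  have := intervalIntegral.integral_comp_sub_left (a := 0) (b := x) (fun y => a y * b (x - y)) x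
  simp only [sub_sub_cancel, sub_self, sub_zero] at this
  simp only [halfConv, this]
  exact intervalIntegral.integral_congr fun y _ => mul_comm _ _

theorem halfConv_nonneg {a b : ℝ → ℝ} (ha : ∀ x, 0 ≤ a x) (hb : ∀ x, 0 ≤ b x) {x : ℝ}
    (hx : 0 ≤ x) : 0 ≤ halfConv a b x :=
  intervalIntegral.integral_nonneg hx fun _ _ => mul_nonneg (ha _) (hb _)

/-- Replacing a factor of a convolution by an asymptotically equivalent one, up to the
contribution of the edge where that factor is evaluated at bounded arguments. -/
theorem halfConv_sub_isLittleO {a b b' Q : ℝ → ℝ} (ha : LocBdd a) (hb : LocBdd b)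
    (hb' : LocBdd b') (ha0 : ∀ x, 0 ≤ a x) (hb0 : ∀ x, 0 ≤ b x) (h : b' ~[atTop] b)
    (hQ0 : ∀ x, 0 ≤ Q x)
    (hQ : ∀ A, ∀ ε > 0, ∀ᶠ x in atTop, ∀ y ∈ Icc 0 A, a (x - y) ≤ ε * Q x) :
    (fun x => halfConv a b' x - halfConv a b x) =o[atTop] (fun x => halfConv a b x + Q x) := by
  rw [isLittleO_iff]
  intro ε hε
  obtain ⟨A, hA⟩ := eventually_atTop.1 ((isLittleO_iff.1 h.isLittleO hε).and
    (eventually_ge_atTop (0 : ℝ)))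
  have hA0 : 0 ≤ A := (hA A le_rfl).2
  obtain ⟨hi, C, hC⟩ := (hb'.sub hb) A hA0
  have hC0 : 0 ≤ C := (abs_nonneg _).trans (hC 0 ⟨le_rfl, hA0⟩)
  filter_upwards [hQ A (ε / ((C + 1) * (A + 1))) (by positivity), eventually_ge_atTop A]
    with x hx hAx
  have hx0 : 0 ≤ x := hA0.trans hAx
  have i1 := ha.intervalIntegrable_conv hb hx0
  have i2 := ha.intervalIntegrable_conv (hb'.sub hb) hx0
  have u1 : uIcc 0 A ⊆ uIcc 0 x := by
    rw [uIcc_of_le hA0, uIcc_of_le hx0]; exact Icc_subset_Icc_right hAx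
  have u2 : uIcc A x ⊆ uIcc 0 x := by
    rw [uIcc_of_le hAx, uIcc_of_le hx0]; exact Icc_subset_Icc_left hA0
  have e : halfConv a b' x - halfConv a b x
      = (∫ y in (0 : ℝ)..A, a (x - y) * (b' y - b y)) + ∫ y in A..x, a (x - y) * (b' y - b y) := by
    rw [intervalIntegral.integral_add_adjacent_intervals (i2.mono_set u1) (i2.mono_set u2)]
    simp only [halfConv]
    rw [← intervalIntegral.integral_sub (ha.intervalIntegrable_conv hb' hx0) i1]
    simp only [mul_sub]
  have b1 : ‖∫ y in (0 : ℝ)..A, a (x - y) * (b' y - b y)‖ ≤ ε * Q x := by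
    have hq : 0 ≤ ε / ((C + 1) * (A + 1)) * Q x := mul_nonneg (by positivity) (hQ0 x)
    refine (intervalIntegral.norm_integral_le_of_norm_le_const
      (C := ε / ((C + 1) * (A + 1)) * Q x * C) fun y hy => ?_).trans ?_
    · rw [uIoc_of_le hA0] at hy
      rw [norm_mul, Real.norm_of_nonneg (ha0 _)]
      exact mul_le_mul (hx y ⟨hy.1.le, hy.2⟩) (hC y ⟨hy.1.le, hy.2⟩) (abs_nonneg _) hq
    · rw [sub_zero, abs_of_nonneg hA0]
      have : ε / ((C + 1) * (A + 1)) * Q x * C * A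
          = (ε * Q x) * ((C * A) / ((C + 1) * (A + 1))) := by ring
      rw [this]
      refine mul_le_of_le_one_right (mul_nonneg hε.le (hQ0 x)) ?_
      rw [div_le_one (by positivity)]
      nlinarith
  have b2 : ‖∫ y in A..x, a (x - y) * (b' y - b y)‖ ≤ ε * halfConv a b x := by
    have h1 : ‖∫ y in A..x, a (x - y) * (b' y - b y)‖
        ≤ ∫ y in A..x, ε * (a (x - y) * b y) := by
      refine intervalIntegral.norm_integral_le_of_norm_le hAx ?_ ((i1.mono_set u2).const_mul ε)
      refine ae_of_all _ fun y hy => ?_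
      have := (hA y hy.1.le).1
      rw [Pi.sub_apply, Real.norm_of_nonneg (hb0 y)] at this
      rw [norm_mul, Real.norm_of_nonneg (ha0 _)]
      nlinarith [mul_le_mul_of_nonneg_left this (ha0 (x - y))]
    refine h1.trans ?_
    rw [intervalIntegral.integral_const_mul]
    refine mul_le_mul_of_nonneg_left ?_ hε.le
    simp only [halfConv]
    rw [← intervalIntegral.integral_add_adjacent_intervals (i1.mono_set u1) (i1.mono_set u2)]
    exact le_add_of_nonneg_left
      (intervalIntegral.integral_nonneg hA0 fun _ _ => mul_nonneg (ha0 _) (hb0 _))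
  rw [e, Real.norm_of_nonneg (add_nonneg (halfConv_nonneg ha0 hb0 hx0) (hQ0 x))]
  calc _ ≤ _ := norm_add_le _ _
    _ ≤ ε * Q x + ε * halfConv a b x := add_le_add b1 b2
    _ = _ := by ring

theorem rightTail_nonneg (μ : Measure ℝ) (x : ℝ) : 0 ≤ rightTail μ x := measureReal_nonneg

theorem sumTail_nonneg (μ ν : Measure ℝ) (x : ℝ) : 0 ≤ sumTail μ ν x := measureReal_nonneg

section Tails

variable (μ ν : Measure ℝ) [IsProbabilityMeasure μ] [IsProbabilityMeasure ν]

theorem rightTail_antitone : Antitone (rightTail μ) :=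
  fun _ _ h => measureReal_mono (Ioi_subset_Ioi h)

theorem rightTail_le_one (x : ℝ) : rightTail μ x ≤ 1 := measureReal_le_one

theorem rightTail_locBdd : LocBdd (rightTail μ) := .of_antitone (rightTail_antitone μ)

theorem sumTail_antitone : Antitone (sumTail μ ν) :=
  fun _ _ h => measureReal_mono fun _ hp => lt_of_le_of_lt h hp

theorem measurableSet_lt_add (x : ℝ) : MeasurableSet {p : ℝ × ℝ | x < p.1 + p.2} :=
  measurableSet_lt measurable_const (measurable_fst.add measurable_snd)

theorem sumTail_comm (x : ℝ) : sumTail μ ν x = sumTail ν μ x := by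
  simp only [sumTail, measureReal_def]
  rw [← Measure.prod_swap, Measure.map_apply measurable_swap (measurableSet_lt_add x)]
  congr 2
  ext p
  simp [add_comm]

theorem ofReal_sumTail (x : ℝ) :
    ENNReal.ofReal (sumTail μ ν x) = ∫⁻ u, ENNReal.ofReal (rightTail μ (x - u)) ∂ν := by
  rw [sumTail, ofReal_measureReal, Measure.prod_apply_symm (measurableSet_lt_add x)]
  refine lintegral_congr fun u => ?_
  rw [rightTail, ofReal_measureReal]
  congr 1
  ext v
  simp [sub_lt_iff_lt_add]

theorem measurable_rightTail_sub (x : ℝ) : Measurable fun u => rightTail μ (x - u) :=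
  (rightTail_antitone μ).measurable.comp (measurable_const.sub measurable_id)

theorem integrable_rightTail_sub (x : ℝ) : Integrable (fun u => rightTail μ (x - u)) ν :=
  Integrable.of_bound (measurable_rightTail_sub μ x).aestronglyMeasurable 1
    (ae_of_all _ fun u => by
      rw [Real.norm_of_nonneg (rightTail_nonneg μ _)]; exact rightTail_le_one μ _)

theorem sumTail_eq_integral (x : ℝ) : sumTail μ ν x = ∫ u, rightTail μ (x - u) ∂ν := by
  rw [integral_eq_lintegral_of_nonneg_ae (ae_of_all _ fun u => rightTail_nonneg μ _)
    (measurable_rightTail_sub μ x).aestronglyMeasurable, ← ofReal_sumTail,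
    ENNReal.toReal_ofReal (sumTail_nonneg μ ν x)]

end Tails

theorem hasExpTail_of_slowlyVarying {μ : Measure ℝ} {α : ℝ} {f l : ℝ → ℝ}
    (hl : ∀ t : ℝ, 0 < t → Tendsto (fun x => l (x * t) / l x) atTop (𝓝 1))
    (hf : ∀ x, f x = l (Real.exp x))
    (htail : rightTail μ ~[atTop] (fun x => Real.exp (-α * x) * f x)) : HasExpTail μ α := by
  intro s
  have h1 : Tendsto (fun x => f (x + s) / f x) atTop (𝓝 1) := by
    simp only [hf, Real.exp_add]
    exact (hl _ (Real.exp_pos s)).comp Real.tendsto_exp_atTop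
  have h2 : Tendsto (fun x => (Real.exp (-α * (x + s)) * f (x + s)) / (Real.exp (-α * x) * f x))
      atTop (𝓝 (Real.exp (-α * s))) := by
    have := h1.const_mul (Real.exp (-α * s))
    rw [mul_one] at this
    refine this.congr fun x => ?_
    rw [mul_add, Real.exp_add, mul_comm (Real.exp (-α * x)), mul_assoc, mul_div_assoc,
      mul_div_mul_left _ _ (Real.exp_pos _).ne']
  have h3 := htail.comp_tendsto (tendsto_atTop_add_const_right atTop s tendsto_id)
  exact ((h3.div htail).tendsto_nhds_iff).2 h2

section ExpTail

variable {μ ν : Measure ℝ} [IsProbabilityMeasure μ] [IsProbabilityMeasure ν] {α : ℝ}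

theorem HasExpTail.pos (h : HasExpTail μ α) (x : ℝ) : 0 < rightTail μ x := by
  have h0 := (h 0).eventually_ne (Real.exp_pos _).ne'
  obtain ⟨y, hy, hxy⟩ := (h0.and (eventually_ge_atTop x)).exists
  have : rightTail μ y ≠ 0 := fun h => hy (by simp [h])
  exact ((rightTail_nonneg μ y).lt_of_ne' this).trans_le (rightTail_antitone μ hxy)

/-- Divergence of `∫ f` forces the exponential moment of order `α` to be infinite. -/
theorem lintegral_exp_eq_top {f : ℝ → ℝ} (hα : 0 < α) (hfb : LocBdd f)
    (hf : f ~[atTop] (fun x => Real.exp (α * x) * rightTail ν x))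
    (hdiv : Tendsto (fun x => ∫ y in (0:ℝ)..x, f y) atTop atTop) :
    ∫⁻ u, ENNReal.ofReal (Real.exp (α * u)) ∂ν = ⊤ := by
  by_contra hfin
  obtain ⟨A, hA⟩ := eventually_atTop.1 ((isLittleO_iff.1 hf.isLittleO one_pos).and
    (eventually_ge_atTop (0 : ℝ)))
  have hA0 : 0 ≤ A := (hA A le_rfl).2
  have layer := lintegral_comp_eq_lintegral_meas_lt_mul ν (f := fun u => max u 0)
    (g := fun t => α * Real.exp (α * t)) (ae_of_all _ fun u => le_max_right _ _) (by fun_prop)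
    (fun t _ => Continuous.intervalIntegrable (by fun_prop) _ _)
    (ae_of_all _ fun t => by positivity)
  have prim : ∀ r : ℝ, ∫ t in (0:ℝ)..r, α * Real.exp (α * t) = Real.exp (α * r) - 1 := by
    intro r
    rw [intervalIntegral.integral_const_mul, intervalIntegral.integral_comp_mul_left _ hα.ne']
    simp [hα.ne']
  have hle :
      ∫⁻ t in Ioi (0 : ℝ), ν {a | t < max a 0} * ENNReal.ofReal (α * Real.exp (α * t)) ≠ ⊤ := by
    rw [← layer]
    refine ne_top_of_le_ne_top hfin (lintegral_mono fun u => ?_)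
    refine ENNReal.ofReal_le_ofReal ?_
    rw [prim]
    rcases le_total u 0 with hu | hu
    · simpa [max_eq_right hu] using (Real.exp_pos _).le
    · simp [max_eq_left hu]
  set I := ∫⁻ t in Ioi (0 : ℝ), ν {a | t < max a 0} * ENNReal.ofReal (α * Real.exp (α * t))
  have hbd : ∀ x, A ≤ x → ∫ y in A..x, f y ≤ 2 / α * I.toReal := by
    intro x hx
    have hanti : IntervalIntegrable (fun t => rightTail ν t * (α * Real.exp (α * t))) volume A x :=
      (rightTail_antitone ν).intervalIntegrable.mul_continuousOn (by fun_prop)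
    have h1 : ∫ y in A..x, f y ≤ ∫ y in A..x, 2 / α * (rightTail ν y * (α * Real.exp (α * y))) := by
      refine intervalIntegral.integral_mono_on hx ?_ (hanti.const_mul _) fun y hy => ?_
      · refine (hfb x (hA0.trans hx)).1.mono_set ?_
        rw [uIcc_of_le hx, uIcc_of_le (hA0.trans hx)]
        exact Icc_subset_Icc_left hA0
      · have h2 := (hA y hy.1).1
        have h3 : 0 ≤ Real.exp (α * y) * rightTail ν y :=
          mul_nonneg (Real.exp_pos _).le (rightTail_nonneg ν y)
        rw [Pi.sub_apply, one_mul, Real.norm_of_nonneg h3] at h2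
        have h4 := (le_abs_self _).trans h2
        have : 2 / α * (rightTail ν y * (α * Real.exp (α * y)))
            = 2 * (Real.exp (α * y) * rightTail ν y) := by field_simp
        linarith
    rw [intervalIntegral.integral_const_mul] at h1
    refine h1.trans (mul_le_mul_of_nonneg_left ?_ (by positivity))
    rw [intervalIntegral.integral_of_le hx, integral_eq_lintegral_of_nonneg_ae
      (ae_of_all _ fun y => mul_nonneg (rightTail_nonneg ν y) (by positivity))
      ((intervalIntegrable_iff_integrableOn_Ioc_of_le hx).1 hanti).aestronglyMeasurable]
    refine ENNReal.toReal_mono hle ?_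
    refine (lintegral_mono_set fun y hy => hA0.trans_lt hy.1).trans ?_
    refine setLIntegral_mono' measurableSet_Ioi fun y hy => ?_
    rw [ENNReal.ofReal_mul (rightTail_nonneg ν y), rightTail, ofReal_measureReal]
    gcongr
    exact fun u (hu : y < u) => show y < max u 0 from lt_max_of_lt_left hu
  obtain ⟨x, hx, hAx⟩ := ((hdiv.eventually_gt_atTop
    ((∫ y in (0:ℝ)..A, f y) + 2 / α * I.toReal)).and (eventually_ge_atTop A)).exists
  have i1 := (hfb A hA0).1
  have i2 := i1.symm.trans (hfb x (hA0.trans hAx)).1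
  rw [← intervalIntegral.integral_add_adjacent_intervals i1 i2] at hx
  linarith [hbd x hAx]

/-- The tail of `μ` is negligible with respect to that of `μ ∗ ν`
if `ν` has infinite exponential moment. -/
theorem HasExpTail.isLittleO_sumTail (h : HasExpTail μ α)
    (hν : ∫⁻ u, ENNReal.ofReal (Real.exp (α * u)) ∂ν = ⊤) (A : ℝ) :
    (fun x => rightTail μ (x - A)) =o[atTop] sumTail μ ν := by
  have fatou : (⊤ : ENNReal) ≤ liminf (fun x => ∫⁻ u, ENNReal.ofReal
      (rightTail μ (x - u) / rightTail μ x) ∂ν) atTop := by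
    rw [← hν]
    refine le_trans (le_of_eq (lintegral_congr fun u => ?_)) (lintegral_liminf_le fun x =>
      ((measurable_rightTail_sub μ x).div_const _).ennreal_ofReal)
    have := (ENNReal.continuous_ofReal.tendsto _).comp (h (-u))
    simp only [Function.comp_def, ← sub_eq_add_neg, neg_mul_neg] at this
    exact this.liminf_eq.symm
  have hzero : rightTail μ =o[atTop] sumTail μ ν := by
    rw [isLittleO_iff]
    intro ε hε
    have : ENNReal.ofReal (1 / ε) < liminf (fun x => ∫⁻ u, ENNReal.ofReal
      (rightTail μ (x - u) / rightTail μ x) ∂ν) atTop := lt_of_lt_of_le (by simp) fatou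
    filter_upwards [eventually_lt_of_lt_liminf this] with x hx
    have hp := h.pos x
    simp only [div_eq_mul_inv, ENNReal.ofReal_mul (rightTail_nonneg μ _)] at hx
    rw [lintegral_mul_const _ (measurable_rightTail_sub μ x).ennreal_ofReal, ← ofReal_sumTail,
      ← ENNReal.ofReal_mul (sumTail_nonneg μ ν x), ← div_eq_mul_inv, ← div_eq_mul_inv] at hx
    have := (ENNReal.ofReal_lt_ofReal_iff_of_nonneg (by positivity)).1 hx
    rw [div_lt_div_iff₀ hε hp] at this
    rw [Real.norm_of_nonneg hp.le, Real.norm_of_nonneg (sumTail_nonneg μ ν x)]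
    linarith
  refine IsBigO.trans_isLittleO ?_ hzero
  have := (h (-A)).isBigO_one ℝ
  have := this.mul (isBigO_refl (rightTail μ) atTop)
  refine this.congr (fun x => ?_) fun x => one_mul _
  rw [div_mul_cancel₀ _ (h.pos x).ne', sub_eq_add_neg]

/-- If the tail of `ν` is negligible, the convolution inherits the exponential tail of `μ`. -/
theorem HasExpTail.sumTail_shift (h : HasExpTail μ α)
    (hν : ∀ A, (fun x => rightTail ν (x - A)) =o[atTop] sumTail μ ν) (s : ℝ) :
    (fun x => sumTail μ ν (x + s) - Real.exp (-α * s) * sumTail μ ν x) =o[atTop]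
      sumTail μ ν := by
  rw [isLittleO_iff]
  intro ε hε
  set κ := Real.exp (-α * s)
  have hκ : 0 < κ := Real.exp_pos _
  obtain ⟨A, hA⟩ := eventually_atTop.1 ((h s).eventually (Metric.ball_mem_nhds κ (half_pos hε)))
  have hA' : ∀ z, A ≤ z → |rightTail μ (z + s) - κ * rightTail μ z| ≤ ε / 2 * rightTail μ z := by
    intro z hz
    have hp := h.pos z
    have := hA z hz
    rw [Real.dist_eq, abs_sub_lt_iff, sub_lt_iff_lt_add, sub_lt_comm, div_lt_iff₀ hp,
      lt_div_iff₀ hp] at this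
    rw [abs_le]
    constructor <;> nlinarith [this.1, this.2]
  filter_upwards [isLittleO_iff.1 (hν A) (show 0 < ε / 2 / (1 + κ) by positivity)] with x hx
  rw [Real.norm_of_nonneg (rightTail_nonneg ν _), Real.norm_of_nonneg (sumTail_nonneg μ ν x)] at hx
  rw [Real.norm_of_nonneg (sumTail_nonneg μ ν x), sumTail_eq_integral μ ν (x + s)]
  nth_rw 1 [sumTail_eq_integral μ ν x]
  rw [← integral_const_mul, ← integral_sub (integrable_rightTail_sub μ ν _)
    ((integrable_rightTail_sub μ ν _).const_mul κ)]
  have hind : Integrable ((Ioi (x - A)).indicator fun _ => 1 + κ) ν :=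
    (integrable_const _).indicator measurableSet_Ioi
  refine (norm_integral_le_of_norm_le
    (((integrable_rightTail_sub μ ν x).const_mul (ε / 2)).add hind)
    (ae_of_all _ fun u => ?_)).trans ?_
  · have e : x + s - u = x - u + s := by ring
    rw [e, Real.norm_eq_abs, Pi.add_apply]
    by_cases hu : u ∈ Ioi (x - A)
    · rw [indicator_of_mem hu, abs_le]
      have h1 := rightTail_nonneg μ (x - u)
      have h2 := rightTail_nonneg μ (x - u + s)
      have h3 := rightTail_le_one μ (x - u)
      have h4 := rightTail_le_one μ (x - u + s)
      have h5 : 0 ≤ ε / 2 * rightTail μ (x - u) := by positivity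
      constructor <;> nlinarith
    · rw [indicator_of_notMem hu, add_zero]
      exact hA' _ (by simp at hu; linarith)
  · rw [integral_add' ((integrable_rightTail_sub μ ν x).const_mul (ε / 2)) hind,
      integral_const_mul, ← sumTail_eq_integral, integral_indicator measurableSet_Ioi,
      setIntegral_const, smul_eq_mul, ← rightTail]
    rw [div_mul_eq_mul_div, le_div_iff₀ (by positivity)] at hx
    linarith

end ExpTail

section Sandwich

variable (μ ν : Measure ℝ) [IsProbabilityMeasure μ] [IsProbabilityMeasure ν]

theorem ofReal_rightTail_sub {x δ : ℝ} (hδ : 0 ≤ δ) :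
    ENNReal.ofReal (rightTail ν x - rightTail ν (x + δ)) = ν (Ioc x (x + δ)) := by
  rw [← Ioi_sdiff_Ioi, ← ofReal_measureReal, measureReal_sdiff (Ioi_subset_Ioi (by linarith))
    measurableSet_Ioi]
  rfl

theorem increment_locBdd (δ : ℝ) : LocBdd fun y => rightTail ν y - rightTail ν (y + δ) :=
  (rightTail_locBdd ν).sub
    (.of_antitone ((rightTail_antitone ν).comp_monotone (monotone_id.add_const δ)))

theorem increment_nonneg {δ : ℝ} (hδ : 0 ≤ δ) (y : ℝ) :
    0 ≤ rightTail ν y - rightTail ν (y + δ) :=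
  sub_nonneg.2 (rightTail_antitone ν (by linarith))

theorem ofReal_halfConv_increment {x δ : ℝ} (hx : 0 ≤ x) (hδ : 0 ≤ δ) :
    ENNReal.ofReal (halfConv (rightTail μ) (fun y => rightTail ν y - rightTail ν (y + δ)) x) =
      ∫⁻ u, (∫⁻ y in Ioc 0 x,
        (Ico (u - δ) u).indicator (fun y => ENNReal.ofReal (rightTail μ (x - y))) y) ∂ν := by
  have hint := (rightTail_locBdd μ).intervalIntegrable_conv (increment_locBdd ν δ) hx
  rw [halfConv, intervalIntegral.integral_of_le hx, ofReal_integral_eq_lintegral_ofReal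
    ((intervalIntegrable_iff_integrableOn_Ioc_of_le hx).1 hint)
    (ae_of_all _ fun y => mul_nonneg (rightTail_nonneg μ _) (increment_nonneg ν hδ y))]
  have hS : MeasurableSet {p : ℝ × ℝ | p.1 - δ ≤ p.2 ∧ p.2 < p.1} :=
    (measurableSet_le (measurable_fst.sub_const δ) measurable_snd).inter
      (measurableSet_lt measurable_snd measurable_fst)
  have hg : Measurable fun p : ℝ × ℝ => ENNReal.ofReal (rightTail μ (x - p.2)) :=
    ((measurable_rightTail_sub μ x).comp measurable_snd).ennreal_ofReal
  have hmeas := (hg.indicator hS).aemeasurable (μ := ν.prod (volume.restrict (Ioc 0 x)))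
  have hswap := lintegral_lintegral_swap (μ := ν) (ν := volume.restrict (Ioc 0 x))
    (f := fun u y => (Ico (u - δ) u).indicator
      (fun y => ENNReal.ofReal (rightTail μ (x - y))) y) hmeas
  rw [hswap]
  refine lintegral_congr fun y => ?_
  have : ∀ u, (Ico (u - δ) u).indicator (fun y => ENNReal.ofReal (rightTail μ (x - y))) y
      = (Ioc y (y + δ)).indicator (fun _ => ENNReal.ofReal (rightTail μ (x - y))) u := by
    intro u
    simp only [indicator_apply, mem_Ico, mem_Ioc, sub_le_iff_le_add, and_comm]
  simp only [this]
  rw [lintegral_indicator_const measurableSet_Ioc, ENNReal.ofReal_mul (rightTail_nonneg μ _),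
    ofReal_rightTail_sub ν hδ]

theorem lintegral_indicator_Ico_const (u δ : ℝ) (c : ENNReal) :
    ∫⁻ y, (Ico (u - δ) u).indicator (fun _ => c) y = c * ENNReal.ofReal δ := by
  rw [lintegral_indicator_const measurableSet_Ico, Real.volume_Ico, sub_sub_cancel]

theorem halfConv_increment_le {x δ : ℝ} (hx : 0 ≤ x) (hδ : 0 ≤ δ) :
    halfConv (rightTail μ) (fun y => rightTail ν y - rightTail ν (y + δ)) x
      ≤ δ * sumTail μ ν x := by
  rw [← ENNReal.ofReal_le_ofReal_iff (mul_nonneg hδ (sumTail_nonneg μ ν x)),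
    ofReal_halfConv_increment μ ν hx hδ, mul_comm, ENNReal.ofReal_mul (sumTail_nonneg μ ν x),
    ofReal_sumTail, ← lintegral_mul_const _ (measurable_rightTail_sub μ x).ennreal_ofReal]
  refine lintegral_mono fun u => ?_
  simp only
  rw [← lintegral_indicator_Ico_const u]
  refine (setLIntegral_le_lintegral _ _).trans (lintegral_mono fun y => ?_)
  refine indicator_le_indicator' fun hy => ENNReal.ofReal_le_ofReal (rightTail_antitone μ ?_)
  linarith [hy.2]

theorem le_halfConv_increment {x δ : ℝ} (hx : 0 ≤ x) (hδ : 0 ≤ δ) :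
    δ * sumTail μ ν (x + δ)
      ≤ halfConv (rightTail μ) (fun y => rightTail ν y - rightTail ν (y + δ)) x
        + δ * (rightTail μ x + rightTail ν x) := by
  have hM := halfConv_nonneg (rightTail_nonneg μ) (increment_nonneg ν hδ) hx
  have h1 := rightTail_nonneg μ x
  have h2 := rightTail_nonneg ν x
  rw [← ENNReal.ofReal_le_ofReal_iff (by positivity), ENNReal.ofReal_add hM (by positivity),
    ofReal_halfConv_increment μ ν hx hδ, mul_comm, ENNReal.ofReal_mul (sumTail_nonneg μ ν _),
    ofReal_sumTail, ← lintegral_mul_const _ (measurable_rightTail_sub μ _).ennreal_ofReal,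
    mul_comm δ, ENNReal.ofReal_mul (by positivity), ENNReal.ofReal_add h1 h2]
  have hT : ∫⁻ u, (ENNReal.ofReal (rightTail μ x) + (Ioi x).indicator (fun _ => 1) u)
      * ENNReal.ofReal δ ∂ν
      = (ENNReal.ofReal (rightTail μ x) + ENNReal.ofReal (rightTail ν x)) * ENNReal.ofReal δ := by
    have hm : Measurable ((Ioi x).indicator fun _ : ℝ => (1 : ENNReal)) :=
      measurable_const.indicator measurableSet_Ioi
    rw [lintegral_mul_const _ (hm.const_add _), lintegral_add_left measurable_const,
      lintegral_indicator_const measurableSet_Ioi, rightTail, rightTail, ofReal_measureReal,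
      ofReal_measureReal]
    simp
  rw [← hT, ← lintegral_add_right _ (by
    exact ((measurable_const.indicator measurableSet_Ioi).const_add _).mul_const _)]
  refine lintegral_mono fun u => ?_
  simp only
  rw [← lintegral_indicator_Ico_const u, ← lintegral_indicator_Ico_const u,
    ← lintegral_indicator measurableSet_Ioc, ← lintegral_add_right _
      (measurable_const.indicator measurableSet_Ico)]
  refine lintegral_mono fun y => ?_
  by_cases hy : y ∈ Ico (u - δ) u
  · simp only [indicator_of_mem hy]
    rcases le_or_gt y 0 with h0 | h0
    · refine le_add_left (le_add_right (ENNReal.ofReal_le_ofReal (rightTail_antitone μ ?_)))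
      linarith [hy.1]
    rcases le_or_gt y x with hyx | hyx
    · rw [indicator_of_mem (show y ∈ Ioc 0 x from ⟨h0, hyx⟩)]
      refine le_add_right ?_
      rw [indicator_of_mem hy]
      refine ENNReal.ofReal_le_ofReal (rightTail_antitone μ ?_)
      linarith [hy.1]
    · rw [indicator_of_mem (show u ∈ Ioi x from hyx.trans hy.2)]
      refine le_add_left (le_add_left ?_)
      rw [← ENNReal.ofReal_one]
      exact ENNReal.ofReal_le_ofReal (rightTail_le_one μ _)
  · rw [indicator_of_notMem hy]
    exact zero_le

end Sandwich

theorem halfConv_const_mul (a b : ℝ → ℝ) (c x : ℝ) :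
    halfConv a (fun y => c * b y) x = c * halfConv a b x := by
  simp only [halfConv, ← intervalIntegral.integral_const_mul]
  exact intervalIntegral.integral_congr fun y _ => mul_left_comm _ _ _

theorem eventually_forall_edge_le {μ : Measure ℝ} [IsProbabilityMeasure μ] {F Q : ℝ → ℝ}
    (hF : F ~[atTop] rightTail μ) (hQ0 : ∀ x, 0 ≤ Q x)
    (hQ : ∀ A, (fun x => rightTail μ (x - A)) =o[atTop] Q) (A ε : ℝ) (hε : 0 < ε) :
    ∀ᶠ x in atTop, ∀ y ∈ Icc 0 A, F (x - y) ≤ ε * Q x := by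
  obtain ⟨z, hz⟩ := eventually_atTop.1 (isLittleO_iff.1 hF.isLittleO one_pos)
  filter_upwards [isLittleO_iff.1 (hQ A) (half_pos hε), eventually_ge_atTop (z + A)]
    with x hx hzx y hy
  have h1 := hz (x - y) (by linarith [hy.2])
  rw [Real.norm_of_nonneg (rightTail_nonneg μ _), Pi.sub_apply, one_mul] at h1
  have h2 := (le_abs_self _).trans h1
  have h3 := rightTail_antitone μ (show x - A ≤ x - y by linarith [hy.2])
  rw [Real.norm_of_nonneg (rightTail_nonneg μ _), Real.norm_of_nonneg (hQ0 x)] at hx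
  linarith

section Asymptotics

variable {μ ν : Measure ℝ} [IsProbabilityMeasure μ] [IsProbabilityMeasure ν] {α : ℝ}

theorem HasExpTail.increment_isEquivalent (h : HasExpTail ν α) {δ : ℝ}
    (hκ : Real.exp (-α * δ) ≠ 1) :
    (fun y => rightTail ν y - rightTail ν (y + δ)) ~[atTop]
      fun y => (1 - Real.exp (-α * δ)) * rightTail ν y := by
  have hκ' : 1 - Real.exp (-α * δ) ≠ 0 := sub_ne_zero.2 hκ.symm
  refine isEquivalent_of_tendsto_one ?_
  have := ((h δ).const_sub 1).div_const (1 - Real.exp (-α * δ))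
  rw [div_self hκ'] at this
  refine this.congr fun y => ?_
  have hp := (h.pos y).ne'
  simp only [Pi.div_apply]
  field_simp

theorem halfConv_increment_sub_isLittleO (hα : 0 < α) (hν : HasExpTail ν α)
    (hμo : ∀ A, (fun x => rightTail μ (x - A)) =o[atTop] sumTail μ ν)
    {δ : ℝ} (hδ : 0 < δ) :
    (fun x => halfConv (rightTail μ) (fun y => rightTail ν y - rightTail ν (y + δ)) x
      - (1 - Real.exp (-α * δ)) * halfConv (rightTail μ) (rightTail ν) x) =o[atTop]
    fun x => (1 - Real.exp (-α * δ)) * halfConv (rightTail μ) (rightTail ν) x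
      + sumTail μ ν x := by
  have hκ : Real.exp (-α * δ) < 1 := Real.exp_lt_one_iff.2 (by nlinarith)
  have hscaled : LocBdd fun y => (1 - Real.exp (-α * δ)) * rightTail ν y := by
    simpa only [mul_comm] using (rightTail_locBdd ν).mul_continuous
      (continuous_const (y := 1 - Real.exp (-α * δ)))
  have := halfConv_sub_isLittleO (rightTail_locBdd μ) hscaled (increment_locBdd ν δ)
    (rightTail_nonneg μ) (fun y => mul_nonneg (by linarith) (rightTail_nonneg ν y))
    (hν.increment_isEquivalent hκ.ne) (sumTail_nonneg μ ν)
    (eventually_forall_edge_le IsEquivalent.refl (sumTail_nonneg μ ν) hμo)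
  simpa only [halfConv_const_mul] using this

theorem halfConv_rightTail_isBigO (hα : 0 < α) (hν : HasExpTail ν α)
    (hμo : ∀ A, (fun x => rightTail μ (x - A)) =o[atTop] sumTail μ ν) :
    halfConv (rightTail μ) (rightTail ν) =O[atTop] sumTail μ ν := by
  have hκ : Real.exp (-α * 1) < 1 := Real.exp_lt_one_iff.2 (by linarith)
  set c := 1 - Real.exp (-α * 1) with hc
  have hc0 : 0 < c := by linarith
  refine IsBigO.of_bound (3 / c) ?_
  filter_upwards [isLittleO_iff.1 (halfConv_increment_sub_isLittleO hα hν hμo one_pos)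
    one_half_pos, eventually_ge_atTop 0] with x hx hx0
  have hL := halfConv_nonneg (rightTail_nonneg μ) (rightTail_nonneg ν) hx0
  have hP := sumTail_nonneg μ ν x
  rw [← hc, Real.norm_of_nonneg (add_nonneg (mul_nonneg hc0.le hL) hP), Real.norm_eq_abs,
    abs_le] at hx
  have hM := halfConv_increment_le μ ν hx0 zero_le_one
  rw [Real.norm_of_nonneg hL, Real.norm_of_nonneg hP, div_mul_eq_mul_div, le_div_iff₀ hc0]
  linarith [hx.1]

/-- The tail of a convolution of two exponential tails, each negligible with respect to it. -/
theorem sumTail_isEquivalent_halfConv_rightTail (hα : 0 < α) (hμ : HasExpTail μ α)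
    (hν : HasExpTail ν α) (hμo : ∀ A, (fun x => rightTail μ (x - A)) =o[atTop] sumTail μ ν)
    (hνo : ∀ A, (fun x => rightTail ν (x - A)) =o[atTop] sumTail μ ν) :
    (fun x => α * halfConv (rightTail μ) (rightTail ν) x) ~[atTop] sumTail μ ν := by
  rw [IsEquivalent, isLittleO_iff]
  intro ε hε
  obtain ⟨δ, hδ, hδ1, hδε⟩ : ∃ δ, 0 < δ ∧ α * δ ≤ 1 ∧ α * δ ≤ ε / 4 := by
    refine ⟨min 1 (ε / 4) / α, by positivity, ?_, ?_⟩ <;> rw [mul_div_cancel₀ _ hα.ne']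
    exacts [min_le_left _ _, min_le_right _ _]
  have hκ1 : Real.exp (-α * δ) < 1 := Real.exp_lt_one_iff.2 (by nlinarith)
  have hκl : 1 - α * δ ≤ Real.exp (-α * δ) := by
    have := Real.add_one_le_exp (-α * δ); linarith
  have hκu : (1 + α * δ) * Real.exp (-α * δ) ≤ 1 := by
    have h1 := Real.add_one_le_exp (α * δ)
    have h2 : Real.exp (α * δ) * Real.exp (-α * δ) = 1 := by rw [← Real.exp_add]; simp
    nlinarith [Real.exp_pos (-α * δ)]
  have hMo := (halfConv_increment_sub_isLittleO hα hν hμo hδ).trans_isBigO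
    (((halfConv_rightTail_isBigO hα hν hμo).const_mul_left _).add (isBigO_refl _ _))
  have hη : 0 < ε / 8 := by positivity
  filter_upwards [isLittleO_iff.1 hMo (mul_pos hη hδ),
    isLittleO_iff.1 (hμ.sumTail_shift hνo δ) hη,
    isLittleO_iff.1 (hμo 0) (half_pos hη), isLittleO_iff.1 (hνo 0) (half_pos hη),
    eventually_ge_atTop 0] with x hMx hsx hμx hνx hx0
  have hP := sumTail_nonneg μ ν x
  have hL := halfConv_nonneg (rightTail_nonneg μ) (rightTail_nonneg ν) hx0
  have hMu := halfConv_increment_le μ ν hx0 hδ.le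
  have hMl := le_halfConv_increment μ ν hx0 hδ.le
  rw [Real.norm_of_nonneg hP, Real.norm_eq_abs, abs_le] at hMx hsx
  rw [sub_zero, Real.norm_of_nonneg hP, Real.norm_of_nonneg (rightTail_nonneg _ _)] at hμx hνx
  rw [Pi.sub_apply, Real.norm_of_nonneg hP, Real.norm_eq_abs, abs_le]
  generalize halfConv (rightTail μ) (fun y => rightTail ν y - rightTail ν (y + δ)) x = M at *
  generalize halfConv (rightTail μ) (rightTail ν) x = L at *
  generalize sumTail μ ν (x + δ) = P' at *
  generalize sumTail μ ν x = P at *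
  generalize Real.exp (-α * δ) = κ at *
  have hupper : (1 - κ) * L ≤ δ * ((1 + ε / 8) * P) := by linarith [hMx.1]
  have hlower : δ * ((κ - 3 * (ε / 8)) * P) ≤ (1 - κ) * L := by
    have h1 : δ * ((κ - ε / 8) * P) ≤ δ * P' :=
      mul_le_mul_of_nonneg_left (by linarith [hsx.1]) hδ.le
    have h2 : δ * (rightTail μ x + rightTail ν x) ≤ δ * (ε / 8 * P) :=
      mul_le_mul_of_nonneg_left (by linarith) hδ.le
    linarith [hMx.2]
  constructor
  · have h1 : δ * ((κ - 3 * (ε / 8)) * P) ≤ δ * (α * L) :=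
      hlower.trans (by nlinarith)
    have h2 := le_of_mul_le_mul_left h1 hδ
    have h3 : (1 - ε / 4) * P ≤ κ * P := mul_le_mul_of_nonneg_right (by linarith) hP
    have : 0 ≤ ε * P := by positivity
    linarith
  · have h1 : δ * (α * L) ≤ δ * ((1 + α * δ) * ((1 + ε / 8) * P)) := by
      calc δ * (α * L) ≤ (1 + α * δ) * ((1 - κ) * L) := by nlinarith
        _ ≤ (1 + α * δ) * (δ * ((1 + ε / 8) * P)) :=
          mul_le_mul_of_nonneg_left hupper (by positivity)
        _ = _ := by ring
    have h2 := le_of_mul_le_mul_left h1 hδ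
    have h3 : (1 + α * δ) * ((1 + ε / 8) * P) ≤ (1 + ε) * P := by
      rw [← mul_assoc]
      exact mul_le_mul_of_nonneg_right (by nlinarith) hP
    linarith

theorem sumTail_isEquivalent_halfConv {F₁ F₂ : ℝ → ℝ} (hα : 0 < α) (hμ : HasExpTail μ α)
    (hν : HasExpTail ν α) (hμo : ∀ A, (fun x => rightTail μ (x - A)) =o[atTop] sumTail μ ν)
    (hνo : ∀ A, (fun x => rightTail ν (x - A)) =o[atTop] sumTail μ ν)
    (hF₁ : F₁ ~[atTop] rightTail μ) (hF₂ : F₂ ~[atTop] rightTail ν)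
    (hF₂0 : ∀ x, 0 ≤ F₂ x) (hF₁b : LocBdd F₁) (hF₂b : LocBdd F₂) :
    sumTail μ ν ~[atTop] fun x => α * halfConv F₁ F₂ x := by
  have hP0 := sumTail_nonneg μ ν
  have hL := halfConv_rightTail_isBigO hα hν hμo
  have h1 : (fun x => halfConv (rightTail μ) F₂ x - halfConv (rightTail μ) (rightTail ν) x)
      =o[atTop] sumTail μ ν :=
    (halfConv_sub_isLittleO (rightTail_locBdd μ) (rightTail_locBdd ν) hF₂b (rightTail_nonneg μ)
      (rightTail_nonneg ν) hF₂ hP0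
      (eventually_forall_edge_le IsEquivalent.refl hP0 hμo)).trans_isBigO
      (hL.add (isBigO_refl _ _))
  have h1' : (fun x => halfConv (rightTail μ) F₂ x) =O[atTop] sumTail μ ν :=
    (h1.isBigO.add hL).congr_left fun x => sub_add_cancel _ _
  have h2 : (fun x => halfConv F₂ F₁ x - halfConv F₂ (rightTail μ) x)
      =o[atTop] sumTail μ ν := by
    refine (halfConv_sub_isLittleO hF₂b (rightTail_locBdd μ) hF₁b hF₂0
      (rightTail_nonneg μ) hF₁ hP0 (eventually_forall_edge_le hF₂ hP0 hνo)).trans_isBigO ?_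
    simp only [halfConv_comm F₂]
    exact h1'.add (isBigO_refl _ _)
  simp only [halfConv_comm F₂] at h2
  refine IsEquivalent.symm ?_
  have h3 := ((h1.add h2).const_mul_left α).add
    (sumTail_isEquivalent_halfConv_rightTail hα hμ hν hμo hνo).isLittleO
  refine h3.congr_left fun x => ?_
  simp only [Pi.sub_apply]
  ring

end Asymptotics

/-- If `P (x + s) ∼ exp (-α s) P x` for all `s`, then `exp (α x) P x` is a slowly varying
function of `exp x`. -/
theorem tendsto_rescaled_log {P : ℝ → ℝ} {α : ℝ} (hshift : ∀ s, (fun x => P (x + s)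
      - Real.exp (-α * s) * P x) =o[atTop] P)
    (hpos : ∀ᶠ x in atTop, 0 < P x) {t : ℝ} (ht : 0 < t) :
    Tendsto (fun x => (Real.exp (α * Real.log (x * t)) * P (Real.log (x * t))) /
      (Real.exp (α * Real.log x) * P (Real.log x))) atTop (𝓝 1) := by
  set s := Real.log t
  have h1 : Tendsto (fun x => (Real.exp (α * (x + s)) * P (x + s)) /
      (Real.exp (α * x) * P x)) atTop (𝓝 1) := by
    have h2 := ((hshift s).tendsto_div_nhds_zero.const_mul (Real.exp (α * s))).add_const 1
    rw [mul_zero, zero_add] at h2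
    refine h2.congr' ?_
    filter_upwards [hpos] with x hx
    have e1 : Real.exp (α * (x + s)) = Real.exp (α * x) * Real.exp (α * s) := by
      rw [← Real.exp_add]; ring_nf
    have e2 : Real.exp (α * s) * Real.exp (-α * s) = 1 := by rw [← Real.exp_add]; simp
    rw [e1, mul_assoc, mul_div_mul_left _ _ (Real.exp_pos _).ne', eq_div_iff hx.ne']
    generalize Real.exp (-α * s) = κ at *
    field_simp
    linear_combination (-P x) * e2
  refine (h1.comp Real.tendsto_log_atTop).congr' ?_
  filter_upwards [eventually_gt_atTop 0] with x hx
  simp only [Function.comp_apply, s, Real.log_mul hx.ne' ht.ne']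

theorem LocBdd.of_tendsto_integral {f : ℝ → ℝ} (hf0 : ∀ x, 0 ≤ f x)
    (hf : ∀ r : ℝ, ∃ C : ℝ, ∀ x ∈ Icc (0:ℝ) r, f x ≤ C)
    (hdiv : Tendsto (fun x => ∫ y in (0:ℝ)..x, f y) atTop atTop) : LocBdd f := by
  intro r hr
  obtain ⟨C, hC⟩ := hf r
  obtain ⟨x, hx, hrx⟩ := ((hdiv.eventually_gt_atTop 0).and (eventually_ge_atTop r)).exists
  refine ⟨?_, C, fun x hx => by rw [abs_of_nonneg (hf0 x)]; exact hC x hx⟩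
  refine IntervalIntegrable.mono_set (a := 0) (b := x) ?_ ?_
  · by_contra h
    exact hx.ne' (intervalIntegral.integral_undef h)
  · rw [uIcc_of_le hr, uIcc_of_le (hr.trans hrx)]
    exact Icc_subset_Icc_right hrx

theorem isEquivalent_exp_mul_of_isEquivalent_exp_neg_mul {T f : ℝ → ℝ} {α : ℝ}
    (h : T ~[atTop] fun x => Real.exp (-α * x) * f x) :
    f ~[atTop] fun x => Real.exp (α * x) * T x := by
  refine ((IsEquivalent.refl (u := fun x => Real.exp (α * x))).mul h).symm.congr_left ?_
  refine Eventually.of_forall fun x => ?_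
  simp only [Pi.mul_apply]
  rw [← mul_assoc, ← Real.exp_add]
  simp

theorem halfConv_exp_mul (f g : ℝ → ℝ) (α x : ℝ) :
    halfConv (fun y => Real.exp (-α * y) * f y) (fun y => Real.exp (-α * y) * g y) x
      = Real.exp (-α * x) * halfConv f g x := by
  simp only [halfConv, ← intervalIntegral.integral_const_mul]
  refine intervalIntegral.integral_congr fun y _ => ?_
  have : Real.exp (-α * x) = Real.exp (-α * (x - y)) * Real.exp (-α * y) := by
    rw [← Real.exp_add]; ring_nf
  simp only [this]
  ring

theorem tendsto_integral_atTop_of_le {f h : ℝ → ℝ} (hf : LocBdd f) (hh : LocBdd h)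
    (hh0 : ∀ x, 0 ≤ h x) {c : ℝ} (hc : 0 < c) (hle : ∀ᶠ x in atTop, f x ≤ c * h x)
    (hdiv : Tendsto (fun x => ∫ y in (0:ℝ)..x, f y) atTop atTop) :
    Tendsto (fun x => ∫ y in (0:ℝ)..x, h y) atTop atTop := by
  obtain ⟨A, hA⟩ := eventually_atTop.1 (hle.and (eventually_ge_atTop (0 : ℝ)))
  have hA0 : 0 ≤ A := (hA A le_rfl).2
  have key : Tendsto (fun x => c * ∫ y in (0:ℝ)..x, h y) atTop atTop := by
    refine tendsto_atTop_mono' _ ?_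
      (tendsto_atTop_add_const_right _ (-∫ y in (0:ℝ)..A, f y) hdiv)
    filter_upwards [eventually_ge_atTop A] with x hx
    have f1 := (hf A hA0).1
    have f2 := f1.symm.trans (hf x (hA0.trans hx)).1
    have h1 := (hh A hA0).1
    have h2 := h1.symm.trans (hh x (hA0.trans hx)).1
    rw [← intervalIntegral.integral_add_adjacent_intervals f1 f2,
      ← intervalIntegral.integral_add_adjacent_intervals h1 h2, mul_add]
    have e1 : ∫ y in A..x, f y ≤ ∫ y in A..x, c * h y :=
      intervalIntegral.integral_mono_on hx f2 (h2.const_mul c) fun y hy => (hA y hy.1).1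
    rw [intervalIntegral.integral_const_mul] at e1
    have e2 : 0 ≤ c * ∫ y in (0:ℝ)..A, h y :=
      mul_nonneg hc.le (intervalIntegral.integral_nonneg hA0 fun y _ => hh0 y)
    linarith
  exact (tendsto_const_mul_atTop_of_pos hc).1 key

theorem memL1_map_add {μ ν : Measure ℝ} [IsProbabilityMeasure μ] [IsProbabilityMeasure ν] {α : ℝ}
    {f : ℝ → ℝ} (hμ : HasExpTail μ α)
    (hμo : ∀ A, (fun x => rightTail μ (x - A)) =o[atTop] sumTail μ ν)
    (hνo : ∀ A, (fun x => rightTail ν (x - A)) =o[atTop] sumTail μ ν) (hfb : LocBdd f)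
    (hf : f ~[atTop] fun x => Real.exp (α * x) * rightTail μ x)
    (hdiv : Tendsto (fun x => ∫ y in (0:ℝ)..x, f y) atTop atTop) :
    MemL1 ((μ.prod ν).map (fun p : ℝ × ℝ => p.1 + p.2)) α := by
  have hle : ∀ᶠ x in atTop, rightTail μ x ≤ sumTail μ ν x := by
    filter_upwards [isLittleO_iff.1 (hμo 0) one_pos] with x hx
    rwa [sub_zero, one_mul, Real.norm_of_nonneg (rightTail_nonneg μ x),
      Real.norm_of_nonneg (sumTail_nonneg μ ν x)] at hx
  have h0 : ∀ x, 0 ≤ Real.exp (α * x) * sumTail μ ν x :=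
    fun x => mul_nonneg (Real.exp_pos _).le (sumTail_nonneg μ ν x)
  have hb : LocBdd fun x => Real.exp (α * x) * sumTail μ ν x := by
    simpa only [mul_comm] using (LocBdd.of_antitone (sumTail_antitone μ ν)).mul_continuous
      (b := fun x => Real.exp (α * x)) (by fun_prop)
  refine ⟨fun x => Real.exp (α * x) * sumTail μ ν x,
    fun x => Real.exp (α * Real.log x) * sumTail μ ν (Real.log x), fun t ht => ?_, fun x => ?_,
    h0, fun r => ?_, ?_, ?_⟩
  · exact tendsto_rescaled_log (hμ.sumTail_shift hνo)
      (hle.mono fun x hx => (hμ.pos x).trans_le hx) ht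
  · simp only [Real.log_exp]
  · rcases le_or_gt 0 r with hr | hr
    · obtain ⟨C, hC⟩ := (hb r hr).2
      exact ⟨C, fun x hx => (le_abs_self _).trans (hC x hx)⟩
    · exact ⟨0, fun x hx => absurd (hx.1.trans hx.2) (not_le.2 hr)⟩
  · refine IsEquivalent.congr_left IsEquivalent.refl (Eventually.of_forall fun x => ?_)
    have hadd : Measurable fun p : ℝ × ℝ => p.1 + p.2 := by fun_prop
    simp only [Measure.map_apply hadd measurableSet_Ioi]
    rw [← mul_assoc, ← Real.exp_add]
    simp only [neg_mul, neg_add_cancel, Real.exp_zero, one_mul]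
    rfl
  · refine tendsto_integral_atTop_of_le hfb hb h0 two_pos ?_ hdiv
    filter_upwards [isLittleO_iff.1 hf.isLittleO one_pos, hle] with x hx hlx
    rw [Pi.sub_apply, one_mul, Real.norm_of_nonneg
      (mul_nonneg (Real.exp_pos _).le (rightTail_nonneg μ x))] at hx
    have h1 := (le_abs_self _).trans hx
    have h2 := mul_le_mul_of_nonneg_left hlx (Real.exp_pos (α * x)).le
    linarith

/-- For independent `Y₁, Y₂` with non-lattice distributions `V₁, V₂ ∈ 𝓛₁(α)`,
`P(Y₁+Y₂ > x) ∼ α e^{-αx} ∫₀ˣ f₁(x-y) f₂(y) dy`, and `V₁ ∗ V₂ ∈ 𝓛₁(α)`. -/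
theorem conv_tail_asymptotics (μ₁ μ₂ : Measure ℝ)
    [IsProbabilityMeasure μ₁] [IsProbabilityMeasure μ₂]
    (α : ℝ) (hα : 0 < α) (f₁ l₁ f₂ l₂ : ℝ → ℝ)
    (hnl1 : ¬ IsLatticeMeasure μ₁) (hnl2 : ¬ IsLatticeMeasure μ₂)
    (hl₁ : ∀ t : ℝ, 0 < t → Tendsto (fun x => l₁ (x * t) / l₁ x) atTop (nhds 1))
    (hl₂ : ∀ t : ℝ, 0 < t → Tendsto (fun x => l₂ (x * t) / l₂ x) atTop (nhds 1))
    (hf₁ : ∀ x, f₁ x = l₁ (Real.exp x)) (hf₂ : ∀ x, f₂ x = l₂ (Real.exp x))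
    (hfnn₁ : ∀ x, 0 ≤ f₁ x) (hfnn₂ : ∀ x, 0 ≤ f₂ x)
    (hlb₁ : ∀ r : ℝ, ∃ C : ℝ, ∀ x ∈ Set.Icc (0:ℝ) r, f₁ x ≤ C)
    (hlb₂ : ∀ r : ℝ, ∃ C : ℝ, ∀ x ∈ Set.Icc (0:ℝ) r, f₂ x ≤ C)
    (htail₁ : (fun x => (μ₁ (Set.Ioi x)).toReal) ~[atTop]
      (fun x => Real.exp (-α * x) * f₁ x))
    (htail₂ : (fun x => (μ₂ (Set.Ioi x)).toReal) ~[atTop]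
      (fun x => Real.exp (-α * x) * f₂ x))
    (hdiv₁ : Tendsto (fun x => ∫ y in (0:ℝ)..x, f₁ y) atTop atTop)
    (hdiv₂ : Tendsto (fun x => ∫ y in (0:ℝ)..x, f₂ y) atTop atTop) :
    ((fun x => ((μ₁.prod μ₂) {p : ℝ × ℝ | x < p.1 + p.2}).toReal) ~[atTop]
      (fun x => α * Real.exp (-α * x) * ∫ y in (0:ℝ)..x, f₁ (x - y) * f₂ y)) ∧
    MemL1 ((μ₁.prod μ₂).map (fun p : ℝ × ℝ => p.1 + p.2)) α := by
  have hb₁ := LocBdd.of_tendsto_integral hfnn₁ hlb₁ hdiv₁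
  have hb₂ := LocBdd.of_tendsto_integral hfnn₂ hlb₂ hdiv₂
  have hT₁ : HasExpTail μ₁ α := hasExpTail_of_slowlyVarying hl₁ hf₁ htail₁
  have hT₂ : HasExpTail μ₂ α := hasExpTail_of_slowlyVarying hl₂ hf₂ htail₂
  have hE₁ := isEquivalent_exp_mul_of_isEquivalent_exp_neg_mul (T := rightTail μ₁) htail₁
  have hE₂ := isEquivalent_exp_mul_of_isEquivalent_exp_neg_mul (T := rightTail μ₂) htail₂
  have ho₁ := hT₁.isLittleO_sumTail (lintegral_exp_eq_top hα hb₂ hE₂ hdiv₂)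
  have ho₂ := hT₂.isLittleO_sumTail (lintegral_exp_eq_top hα hb₁ hE₁ hdiv₁)
  rw [show sumTail μ₂ μ₁ = sumTail μ₁ μ₂ from funext (sumTail_comm μ₂ μ₁)] at ho₂
  refine ⟨?_, memL1_map_add hT₁ ho₁ ho₂ hb₁ hE₁ hdiv₁⟩
  have hexp : Continuous fun x : ℝ => Real.exp (-α * x) := by fun_prop
  have hF : ∀ {f : ℝ → ℝ}, LocBdd f → LocBdd fun x => Real.exp (-α * x) * f x := fun hf => by
    simpa only [mul_comm] using hf.mul_continuous hexp
  refine (sumTail_isEquivalent_halfConv hα hT₁ hT₂ ho₁ ho₂ htail₁.symm htail₂.symm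
    (fun x => mul_nonneg (Real.exp_pos _).le (hfnn₂ x)) (hF hb₁) (hF hb₂)).congr_right
    (Eventually.of_forall fun x => ?_)
  simp only [halfConv_exp_mul, ← mul_assoc]
  rfl
end

section
/- Let Y₁, Y₂ be independent with non-lattice distributions Vᵢ ∈ 𝓛₁₁(α): V̄ᵢ(x) ∼ e^{−αx} fᵢ(x) with α > 0, fᵢ regularly varying of index γᵢ > −1. Then P(Y₁+Y₂ > x) ∼ B(γ₁+1, γ₂+1) · α · e^{−αx} · x · f₁(x) f₂(x) as x → ∞, where B is the Beta function. -/
open Filter MeasureTheory Asymptotics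

/-- The Beta function `B(a,b) = Γ(a)Γ(b)/Γ(a+b)`. -/
noncomputable def Beta (a b : ℝ) : ℝ := Real.Gamma a * Real.Gamma b / Real.Gamma (a + b)

section ConvolutionTail

open Set Topology

/-- The uniform convergence theorem for slowly varying functions, in additive form. -/
theorem eventually_forall_abs_sub_lt_of_tendsto_add {k : ℝ → ℝ} (hk : Measurable k)
    (h : ∀ t, Tendsto (fun s => k (s + t) - k s) atTop (𝓝 0)) {ε : ℝ} (hε : 0 < ε) :
    ∀ᶠ s in atTop, ∀ τ ∈ Icc (0 : ℝ) 1, |k (s + τ) - k s| < ε := by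
  set φ : ℝ → ℝ → ℝ := fun s t => min 1 |k (s + t) - k s| with hφ
  have hφm : ∀ s, Measurable (φ s) := fun s => by
    have h1 : Measurable fun t => k (s + t) := hk.comp (measurable_const_add s)
    exact measurable_const.min (h1.sub_const _).abs
  have hφ0 : ∀ s t, 0 ≤ φ s t := fun s t => le_min zero_le_one (abs_nonneg _)
  have hφ1 : ∀ s t, φ s t ≤ 1 := fun s t => min_le_left _ _
  have hφb : ∀ s t, ‖φ s t‖ ≤ 1 := fun s t => by
    rw [Real.norm_of_nonneg (hφ0 s t)]; exact hφ1 s t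
  have hφi : ∀ s a b, IntervalIntegrable (φ s) volume a b := fun s a b =>
    (intervalIntegrable_const (c := (1 : ℝ))).mono_fun (hφm s).aestronglyMeasurable
      (Eventually.of_forall fun t => by simpa using hφb s t)
  have hF : Tendsto (fun s => ∫ t in (0 : ℝ)..2, φ s t) atTop (𝓝 0) := by
    have := intervalIntegral.tendsto_integral_filter_of_dominated_convergence
      (μ := volume) (a := 0) (b := 2) (l := atTop) (F := φ) (f := fun _ => (0 : ℝ))
      (fun _ => (1 : ℝ))
      (Eventually.of_forall fun s => (hφm s).aestronglyMeasurable)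
      (Eventually.of_forall fun s => Eventually.of_forall fun t _ => hφb s t)
      intervalIntegrable_const
      (Eventually.of_forall fun t _ => by
        have := (tendsto_const_nhds (x := (1 : ℝ))).min (h t).abs
        simpa using this)
    simpa using this
  obtain ⟨S, hS⟩ := eventually_atTop.1
    (hF.eventually (gt_mem_nhds (show 0 < min ε 1 / 2 by positivity)))
  filter_upwards [eventually_ge_atTop S] with s hs τ hτ
  have key : φ s τ < min ε 1 := by
    have e1 : φ s τ = ∫ _t in (1 : ℝ)..2, φ s τ := by norm_num
    have i2 : IntervalIntegrable (fun t => φ (s + τ) (t - τ)) volume 1 2 := by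
      have := (hφi (s + τ) (1 - τ) (2 - τ)).comp_sub_right τ
      simpa using this
    have e2 : (∫ _t in (1 : ℝ)..2, φ s τ) ≤
        ∫ t in (1 : ℝ)..2, (φ s t + φ (s + τ) (t - τ)) := by
      apply intervalIntegral.integral_mono_on (by norm_num) intervalIntegrable_const
        ((hφi s 1 2).add i2)
      intro t _
      have h3 : φ (s + τ) (t - τ) = min 1 |k (s + t) - k (s + τ)| := by
        simp only [hφ]; congr 4; ring
      rw [h3]
      simp only [hφ]
      have h4 : |k (s + τ) - k s| ≤ |k (s + t) - k s| + |k (s + t) - k (s + τ)| := by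
        have := abs_sub_le (k (s + τ)) (k (s + t)) (k s)
        rw [abs_sub_comm (k (s + τ)) (k (s + t))] at this
        linarith
      have := abs_nonneg (k (s + t) - k s)
      have := abs_nonneg (k (s + t) - k (s + τ))
      rcases le_total 1 |k (s + t) - k s| with h5 | h5 <;>
      rcases le_total 1 |k (s + t) - k (s + τ)| with h6 | h6 <;>
      simp only [min_eq_left h5, min_eq_right h5, min_eq_left h6, min_eq_right h6] <;>
      first
        | exact (min_le_left _ _).trans (by linarith)
        | exact (min_le_right _ _).trans (by linarith)
    rw [intervalIntegral.integral_add (hφi s 1 2) i2,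
      intervalIntegral.integral_comp_sub_right (fun t => φ (s + τ) t)] at e2
    have m1 : (∫ t in (1 : ℝ)..2, φ s t) ≤ ∫ t in (0 : ℝ)..2, φ s t :=
      intervalIntegral.integral_mono_interval (by norm_num) (by norm_num) le_rfl
        (Eventually.of_forall (hφ0 s)) (hφi s 0 2)
    have m2 : (∫ t in (1 - τ)..(2 - τ), φ (s + τ) t) ≤ ∫ t in (0 : ℝ)..2, φ (s + τ) t :=
      intervalIntegral.integral_mono_interval (by linarith [hτ.2]) (by linarith)
        (by linarith [hτ.1]) (Eventually.of_forall (hφ0 _)) (hφi _ 0 2)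
    have := hS s hs
    have := hS (s + τ) (by linarith [hτ.1])
    linarith
  have h1 := key.trans_le (min_le_right _ _)
  have h2 := key.trans_le (min_le_left _ _)
  simp only [hφ] at h1 h2
  rcases min_lt_iff.1 h2 with h3 | h3
  · rcases min_lt_iff.1 h1 with h4 | h4
    · exact absurd h4 (lt_irrefl _)
    · exact h4.trans h3
  · exact h3

/-- Iterating the additive uniform convergence theorem gives linear control of increments. -/
theorem eventually_forall_abs_sub_le_of_tendsto_add {k : ℝ → ℝ} (hk : Measurable k)
    (h : ∀ t, Tendsto (fun s => k (s + t) - k s) atTop (𝓝 0)) {ε : ℝ} (hε : 0 < ε) :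
    ∀ᶠ s in atTop, ∀ d, 0 ≤ d → |k (s + d) - k s| ≤ ε * (d + 1) := by
  obtain ⟨S, hS⟩ := eventually_atTop.1 (eventually_forall_abs_sub_lt_of_tendsto_add hk h hε)
  have step : ∀ n : ℕ, ∀ s, S ≤ s → |k (s + n) - k s| ≤ ε * n := by
    intro n
    induction n with
    | zero => intro s _; simp
    | succ n ih =>
      intro s hs
      have h1 := ih s hs
      have h2 := hS (s + n) (by have : (0 : ℝ) ≤ n := n.cast_nonneg; linarith) 1 (by simp)
      have h3 := abs_sub_le (k (s + n + 1)) (k (s + n)) (k s)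
      push_cast
      rw [← add_assoc]
      linarith
  filter_upwards [eventually_ge_atTop S] with s hs d hd
  have h1 := step ⌊d⌋₊ s hs
  have hfl := Nat.floor_le hd
  have hfl' := Nat.lt_floor_add_one d
  have h2 := hS (s + ⌊d⌋₊) (by have : (0 : ℝ) ≤ ⌊d⌋₊ := Nat.cast_nonneg _; linarith)
    (d - ⌊d⌋₊) ⟨by linarith, by linarith⟩
  rw [show s + (⌊d⌋₊ : ℝ) + (d - ⌊d⌋₊) = s + d by ring] at h2
  have h3 := abs_sub_le (k (s + d)) (k (s + ⌊d⌋₊)) (k s)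
  have h4 : ε * ⌊d⌋₊ ≤ ε * d := by gcongr
  linarith

section RegularVariation

variable {g : ℝ → ℝ} {γ : ℝ}

theorem tendsto_log_comp_exp_add_sub (hpos : ∀ x, 0 < g x)
    (hrv : ∀ t : ℝ, 0 < t → Tendsto (fun x => g (x * t) / g x) atTop (𝓝 (t ^ γ))) (t : ℝ) :
    Tendsto (fun s => (Real.log (g (Real.exp (s + t))) - γ * (s + t)) -
      (Real.log (g (Real.exp s)) - γ * s)) atTop (𝓝 0) := by
  have h1 := ((hrv (Real.exp t) (Real.exp_pos t)).comp Real.tendsto_exp_atTop).log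
    (Real.rpow_pos_of_pos (Real.exp_pos t) γ).ne'
  have h2 := h1.sub_const (γ * t)
  rw [Real.log_rpow (Real.exp_pos t), Real.log_exp, sub_self] at h2
  refine h2.congr fun s => ?_
  simp only [Function.comp]
  rw [← Real.exp_add, Real.log_div (hpos _).ne' (hpos _).ne']
  ring

theorem tendsto_add_div_of_regVar (hg : Measurable g) (hpos : ∀ x, 0 < g x)
    (hrv : ∀ t : ℝ, 0 < t → Tendsto (fun x => g (x * t) / g x) atTop (𝓝 (t ^ γ)))
    {t : ℝ} (ht : 0 ≤ t) : Tendsto (fun x => g (x + t) / g x) atTop (𝓝 1) := by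
  set k : ℝ → ℝ := fun s => Real.log (g (Real.exp s)) - γ * s with hkdef
  have hk : Measurable k := by
    have := Real.measurable_log.comp (hg.comp Real.measurable_exp)
    exact this.sub (measurable_id.const_mul γ)
  have hadd := tendsto_log_comp_exp_add_sub hpos hrv
  have hτ : Tendsto (fun x => Real.log (x + t) - Real.log x) atTop (𝓝 0) := by
    have h1 : Tendsto (fun x : ℝ => 1 + t / x) atTop (𝓝 (1 + 0)) :=
      tendsto_const_nhds.add (tendsto_const_nhds.div_atTop tendsto_id)
    have h2 := h1.log (by norm_num)
    simp only [add_zero, Real.log_one] at h2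
    refine h2.congr' ?_
    filter_upwards [eventually_gt_atTop 0] with x hx
    rw [← Real.log_div (by positivity) hx.ne', add_div, div_self hx.ne']
  have hk0 : Tendsto (fun x => k (Real.log (x + t)) - k (Real.log x)) atTop (𝓝 0) := by
    rw [Metric.tendsto_nhds]
    intro ε hε
    filter_upwards [Real.tendsto_log_atTop.eventually
      (eventually_forall_abs_sub_lt_of_tendsto_add hk hadd hε),
      hτ.eventually (gt_mem_nhds zero_lt_one), eventually_gt_atTop 0] with x hx h1 hx0
    have := hx (Real.log (x + t) - Real.log x)
      ⟨sub_nonneg.2 (Real.log_le_log hx0 (by linarith)), h1.le⟩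
    simpa [Real.dist_eq] using this
  have h3 := (hk0.add (hτ.const_mul γ)).rexp
  simp only [mul_zero, add_zero, Real.exp_zero] at h3
  refine h3.congr' ?_
  filter_upwards [eventually_gt_atTop 0] with x hx
  simp only [hkdef]
  rw [Real.exp_log (by positivity), Real.exp_log hx]
  rw [show Real.log (g (x + t)) - γ * Real.log (x + t) - (Real.log (g x) - γ * Real.log x) +
    γ * (Real.log (x + t) - Real.log x) = Real.log (g (x + t)) - Real.log (g x) by ring,
    Real.exp_sub, Real.exp_log (hpos _), Real.exp_log (hpos _)]

/-- A one-sided Potter bound, valid down to the origin. -/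
theorem exists_potter_bound (hg : Measurable g) (hpos : ∀ x, 0 < g x)
    (hbd : ∀ r : ℝ, ∃ M, ∀ y ≤ r, g y ≤ M)
    (hrv : ∀ t : ℝ, 0 < t → Tendsto (fun x => g (x * t) / g x) atTop (𝓝 (t ^ γ)))
    (hγ : -1 < γ) :
    ∃ β C : ℝ, -1 < β ∧ 0 < C ∧
      ∀ᶠ x in atTop, ∀ u, 0 < u → u ≤ 1 → g (x * u) ≤ C * u ^ β * g x := by
  set k : ℝ → ℝ := fun s => Real.log (g (Real.exp s)) - γ * s with hkdef
  have hk : Measurable k := by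
    have := Real.measurable_log.comp (hg.comp Real.measurable_exp)
    exact this.sub (measurable_id.const_mul γ)
  have hadd := tendsto_log_comp_exp_add_sub hpos hrv
  obtain ⟨β, hβ1, hβ0, hβγ⟩ : ∃ β, -1 < β ∧ β < 0 ∧ β < γ := by
    obtain ⟨β, h1, h2⟩ := exists_between (lt_min hγ (neg_one_lt_zero (R := ℝ)))
    exact ⟨β, h1, h2.trans_le (min_le_right _ _), h2.trans_le (min_le_left _ _)⟩
  obtain ⟨S, hS⟩ := eventually_atTop.1
    (eventually_forall_abs_sub_le_of_tendsto_add hk hadd (sub_pos.2 hβγ))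
  set X := Real.exp S with hX
  have hXpos : 0 < X := Real.exp_pos S
  set E := Real.exp (γ - β) with hE
  have main : ∀ x u : ℝ, 0 < u → u ≤ 1 → X ≤ x * u → g (x * u) ≤ E * u ^ β * g x := by
    intro x u hu hu1 hxu
    have hxu0 : 0 < x * u := hXpos.trans_le hxu
    have hx0 : 0 < x := pos_of_mul_pos_left hxu0 hu.le
    have h1 := hS (Real.log (x * u)) ((Real.le_log_iff_exp_le hxu0).2 hxu) (-Real.log u)
      (by linarith [Real.log_nonpos hu.le hu1])
    have h2 : Real.log (x * u) + -Real.log u = Real.log x := by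
      rw [Real.log_mul hx0.ne' hu.ne']; ring
    rw [h2] at h1
    simp only [hkdef] at h1
    rw [Real.exp_log hx0, Real.exp_log hxu0] at h1
    have h3 := (abs_le.1 h1).1
    have h4 : Real.log (g (x * u)) ≤ (γ - β) + Real.log u * β + Real.log (g x) := by
      rw [Real.log_mul hx0.ne' hu.ne'] at h3
      nlinarith
    have h5 := Real.exp_le_exp.2 h4
    rwa [Real.exp_log (hpos _), Real.exp_add, Real.exp_add, Real.exp_log (hpos _),
      ← Real.rpow_def_of_pos hu] at h5
  obtain ⟨M, hM⟩ := hbd X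
  have hM0 : 0 < M := (hpos X).trans_le (hM X le_rfl)
  refine ⟨β, E * max 1 (M / g X), hβ1, by positivity, ?_⟩
  filter_upwards [eventually_ge_atTop X] with x hx u hu hu1
  have hx0 : 0 < x := hXpos.trans_le hx
  have hub : 0 < u ^ β := Real.rpow_pos_of_pos hu β
  have hgx := hpos x
  have hE0 : 0 < E := Real.exp_pos _
  rcases le_or_gt X (x * u) with h | h
  · calc g (x * u) ≤ E * u ^ β * g x := main x u hu hu1 h
      _ = E * 1 * u ^ β * g x := by ring
      _ ≤ _ := by gcongr; exact le_max_left _ _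
  · have h1 := main x (X / x) (by positivity) ((div_le_one hx0).2 hx)
      (by rw [mul_div_cancel₀ _ hx0.ne'])
    rw [mul_div_cancel₀ _ hx0.ne'] at h1
    have h2 : (X / x) ^ β ≤ u ^ β := Real.rpow_le_rpow_of_nonpos hu
      ((le_div_iff₀ hx0).2 (by linarith)) hβ0.le
    calc g (x * u) ≤ M := hM _ h.le
      _ = M / g X * g X := by rw [div_mul_cancel₀ _ (hpos X).ne']
      _ ≤ M / g X * (E * (X / x) ^ β * g x) := by
        have := hpos X
        gcongr
      _ ≤ M / g X * (E * u ^ β * g x) := by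
        have := hpos X
        gcongr
      _ = E * (M / g X) * u ^ β * g x := by ring
      _ ≤ _ := by gcongr; exact le_max_right _ _

theorem tendsto_id_mul_atTop_of_potter {β C : ℝ} (hpos : ∀ x, 0 < g x) (hβ : -1 < β)
    (hC : 0 < C)
    (hP : ∀ᶠ x in atTop, ∀ u, 0 < u → u ≤ 1 → g (x * u) ≤ C * u ^ β * g x) :
    Tendsto (fun x => x * g x) atTop atTop := by
  have h1 : Tendsto (fun x : ℝ => g 1 / C * x ^ (1 + β)) atTop atTop :=
    (tendsto_rpow_atTop (by linarith)).const_mul_atTop (div_pos (hpos 1) hC)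
  refine tendsto_atTop_mono' _ ?_ h1
  filter_upwards [hP, eventually_ge_atTop 1] with x hx hx1
  have hx0 : 0 < x := by linarith
  have h2 := hx (1 / x) (by positivity) ((div_le_one hx0).2 hx1)
  rw [mul_one_div_cancel hx0.ne', one_div, Real.inv_rpow hx0.le] at h2
  have hb : 0 < x ^ β := Real.rpow_pos_of_pos hx0 β
  rw [Real.rpow_add hx0, Real.rpow_one]
  calc g 1 / C * (x * x ^ β) ≤ (C * (x ^ β)⁻¹ * g x) / C * (x * x ^ β) := by gcongr
    _ = x * g x := by field_simp

end RegularVariation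

theorem exists_exp_bound_of_tendsto_add_div {T : ℝ → ℝ} {α : ℝ} (hα : 0 < α)
    (hpos : ∀ x, 0 < T x) (hanti : Antitone T)
    (h : ∀ t, 0 ≤ t → Tendsto (fun x => T (x + t) / T x) atTop (𝓝 (Real.exp (-α * t)))) :
    ∀ᶠ x in atTop, ∀ t, 0 ≤ t → T (x + t) ≤ Real.exp (-(α / 2) * (t - 1)) * T x := by
  have h1 := (h 1 zero_le_one).eventually (gt_mem_nhds (show Real.exp (-α * 1) <
    Real.exp (-(α / 2)) from Real.exp_lt_exp.2 (by linarith)))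
  obtain ⟨X, hX⟩ := eventually_atTop.1 h1
  have step : ∀ n : ℕ, ∀ x, X ≤ x → T (x + n) ≤ Real.exp (-(α / 2) * n) * T x := by
    intro n
    induction n with
    | zero => intro x _; simp
    | succ n ih =>
      intro x hx
      have h2 := hX (x + n) (by have : (0 : ℝ) ≤ n := n.cast_nonneg; linarith)
      rw [div_lt_iff₀ (hpos _)] at h2
      have h3 := mul_le_mul_of_nonneg_left (ih x hx) (Real.exp_pos (-(α / 2))).le
      rw [← mul_assoc, ← Real.exp_add] at h3
      push_cast
      rw [← add_assoc, show -(α / 2) * ((n : ℝ) + 1) = -(α / 2) + -(α / 2) * n by ring]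
      exact h2.le.trans h3
  filter_upwards [eventually_ge_atTop X] with x hx t ht
  have hfl := Nat.floor_le ht
  have hfl' := Nat.lt_floor_add_one t
  calc T (x + t) ≤ T (x + ⌊t⌋₊) := hanti (by linarith)
    _ ≤ _ := step _ x hx
    _ ≤ _ := by
      have := hpos x
      gcongr ?_ * _
      apply Real.exp_le_exp.2
      nlinarith

/-- The integrated tail is asymptotic to the tail. -/
theorem tendsto_integral_tail_div {T : ℝ → ℝ} {α : ℝ} (hα : 0 < α)
    (hpos : ∀ x, 0 < T x) (hanti : Antitone T)
    (h : ∀ t, 0 ≤ t → Tendsto (fun x => T (x + t) / T x) atTop (𝓝 (Real.exp (-α * t)))) :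
    (∀ a, IntegrableOn T (Ioi a)) ∧
      Tendsto (fun x => (∫ y in Ioi x, α * T y) / T x) atTop (𝓝 1) := by
  have hb := exists_exp_bound_of_tendsto_add_div hα hpos hanti h
  have hTm : Measurable T := hanti.measurable
  have hbi : IntegrableOn (fun t : ℝ => Real.exp (-(α / 2) * (t - 1))) (Ioi 0) := by
    have h1 := (integrableOn_exp_mul_Ioi (a := -(α / 2)) (by linarith) 0).const_mul
      (Real.exp (α / 2))
    refine h1.congr (Eventually.of_forall fun t => ?_)
    simp only
    rw [← Real.exp_add]; congr 1; ring
  constructor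
  · obtain ⟨x, hx⟩ := hb.exists
    have h1 : IntegrableOn (fun t => T (x + t)) (Ioi 0) := by
      refine (hbi.mul_const (T x)).mono' (hTm.comp (measurable_const_add x)).aestronglyMeasurable ?_
      refine (ae_restrict_iff' measurableSet_Ioi).2 (Eventually.of_forall fun t ht => ?_)
      rw [Real.norm_of_nonneg (hpos _).le]
      exact hx t (le_of_lt ht)
    have h2 : IntegrableOn T (Ioi x) := by
      have := (measurePreserving_add_left volume x).integrableOn_comp_preimage
        (measurableEmbedding_addLeft x) (f := T) (s := Ioi x)
      rw [← this]
      simpa [Function.comp_def] using h1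
    intro a
    have h3 : IntegrableOn T (Ioc a x) :=
      ((hanti.antitoneOn (Icc a x)).integrableOn_isCompact isCompact_Icc).mono_set
        Ioc_subset_Icc_self
    exact (h3.union h2).mono_set fun y hy => by
      rcases le_or_gt y x with h | h
      · exact Or.inl ⟨hy, h⟩
      · exact Or.inr h
  · have hlim : Tendsto (fun x => ∫ t in Ioi (0 : ℝ), α * (T (x + t) / T x)) atTop
        (𝓝 (∫ t in Ioi (0 : ℝ), α * Real.exp (-α * t))) := by
      apply tendsto_integral_filter_of_dominated_convergence
        (fun t => α * Real.exp (-(α / 2) * (t - 1)))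
      · exact Eventually.of_forall fun x =>
          (((hTm.comp (measurable_const_add x)).div_const _).const_mul α).aestronglyMeasurable
      · filter_upwards [hb] with x hx
        refine (ae_restrict_iff' measurableSet_Ioi).2 (Eventually.of_forall fun t ht => ?_)
        have h1 := hpos x
        have h2 := hpos (x + t)
        rw [Real.norm_of_nonneg (by positivity)]
        gcongr
        exact (div_le_iff₀ h1).2 (hx t (le_of_lt ht))
      · exact hbi.const_mul α
      · exact (ae_restrict_iff' measurableSet_Ioi).2 (Eventually.of_forall fun t ht =>
          (h t (le_of_lt ht)).const_mul α)
    rw [integral_const_mul, integral_exp_mul_Ioi (by linarith)] at hlim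
    have hone : α * (-Real.exp (-α * 0) / -α) = 1 := by
      simp; field_simp
    rw [hone] at hlim
    refine hlim.congr fun x => ?_
    have := (measurePreserving_add_left volume x).setIntegral_preimage_emb
      (measurableEmbedding_addLeft x) (fun y => α * T y / T x) (Ioi x)
    rw [← integral_div, ← this]
    simp [mul_div_assoc]

/-- The tail of the sum of independent variables as an integral. -/
theorem measureReal_prod_lt_add (μ σ : Measure ℝ) [IsFiniteMeasure μ] [IsFiniteMeasure σ] (x : ℝ) :
    (μ.prod σ).real {p : ℝ × ℝ | x < p.1 + p.2} = ∫ z, μ.real (Ioi (x - z)) ∂σ := by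
  have hs : MeasurableSet {p : ℝ × ℝ | x < p.1 + p.2} :=
    measurableSet_lt measurable_const (measurable_fst.add measurable_snd)
  have h1 : ∀ z : ℝ, (fun y : ℝ => (y, z)) ⁻¹' {p : ℝ × ℝ | x < p.1 + p.2} = Ioi (x - z) := by
    intro z; ext y; simp [sub_lt_iff_lt_add]
  have hm := measurable_measure_prodMk_right (μ := μ) hs
  have hp := Measure.prod_apply_symm (μ := μ) (ν := σ) hs
  simp only [h1] at hm hp
  rw [Measure.real, hp, ← integral_toReal hm.aemeasurable
    (Eventually.of_forall fun z => measure_lt_top _ _)]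
  rfl

theorem measureReal_prod_lt_add' (μ σ : Measure ℝ) [IsFiniteMeasure μ] [IsFiniteMeasure σ] (x : ℝ) :
    (μ.prod σ).real {p : ℝ × ℝ | x < p.1 + p.2} = ∫ y, σ.real (Ioi (x - y)) ∂μ := by
  have hs : MeasurableSet {p : ℝ × ℝ | x < p.1 + p.2} :=
    measurableSet_lt measurable_const (measurable_fst.add measurable_snd)
  rw [← measureReal_prod_lt_add σ μ x, ← Measure.prod_swap, Measure.real,
    Measure.map_apply measurable_swap hs, Measure.real]
  congr 2
  ext p; simp [add_comm]

/-- Tail-equivalent measures have equivalent convolution tails, as long as the tail of the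
other factor is negligible. -/
theorem tendsto_conv_tail_div_of_tail_equiv {μ ν σ : Measure ℝ} [IsFiniteMeasure μ]
    [IsFiniteMeasure ν] [IsFiniteMeasure σ] {R : ℝ → ℝ} {L : ℝ}
    (hR : ∀ᶠ x in atTop, 0 < R x)
    (hequiv : Tendsto (fun x => ν.real (Ioi x) / μ.real (Ioi x)) atTop (𝓝 1))
    (hσ : ∀ A, 0 ≤ A → Tendsto (fun x => σ.real (Ioi (x - A)) / R x) atTop (𝓝 0))
    (hμ : Tendsto (fun x => (∫ z, μ.real (Ioi (x - z)) ∂σ) / R x) atTop (𝓝 L)) :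
    Tendsto (fun x => (∫ z, ν.real (Ioi (x - z)) ∂σ) / R x) atTop (𝓝 L) := by
  have hanti : ∀ (κ : Measure ℝ) [IsFiniteMeasure κ], Antitone fun x => κ.real (Ioi x) :=
    fun κ _ a b hab => measureReal_mono (Ioi_subset_Ioi hab)
  have hint : ∀ (κ : Measure ℝ) [IsFiniteMeasure κ] (x : ℝ),
      Integrable (fun z => κ.real (Ioi (x - z))) σ := by
    intro κ _ x
    refine (integrable_const (κ.real univ)).mono'
      ((hanti κ).measurable.comp (measurable_const.sub measurable_id)).aestronglyMeasurable
      (Eventually.of_forall fun z => ?_)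
    rw [Real.norm_of_nonneg measureReal_nonneg]
    exact measureReal_mono (subset_univ _)
  set C := ν.real univ + μ.real univ with hC
  have hC0 : 0 ≤ C := by positivity
  have hpos : ∀ᶠ x in atTop, 0 < μ.real (Ioi x) := by
    filter_upwards [hequiv.eventually (lt_mem_nhds zero_lt_one)] with x hx
    refine lt_of_le_of_ne measureReal_nonneg fun h => ?_
    rw [← h, div_zero] at hx
    exact lt_irrefl _ hx
  have hdiff : Tendsto (fun x => (∫ z, ν.real (Ioi (x - z)) ∂σ) / R x -
      (∫ z, μ.real (Ioi (x - z)) ∂σ) / R x) atTop (𝓝 0) := by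
    rw [Metric.tendsto_nhds]
    intro ε hε
    obtain ⟨δ, hδ0, hδ⟩ : ∃ δ, 0 < δ ∧ δ * L < ε / 2 := by
      refine ⟨ε / (2 * (|L| + 1)), by positivity, ?_⟩
      have h1 : L < |L| + 1 := by linarith [le_abs_self L]
      calc ε / (2 * (|L| + 1)) * L < ε / (2 * (|L| + 1)) * (|L| + 1) := by gcongr
        _ = ε / 2 := by field_simp
    obtain ⟨A, hA⟩ := eventually_atTop.1 ((hequiv.eventually (Metric.ball_mem_nhds 1 hδ0)).and hpos)
    obtain ⟨B, hBA, hB0⟩ : ∃ B, A ≤ B ∧ 0 ≤ B := ⟨max A 0, le_max_left _ _, le_max_right _ _⟩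
    have hpt : ∀ w, |ν.real (Ioi w) - μ.real (Ioi w)| ≤
        δ * μ.real (Ioi w) + C * (Iio B).indicator 1 w := by
      intro w
      rcases lt_or_ge w B with hw | hw
      · have h1 : ν.real (Ioi w) ≤ ν.real univ := measureReal_mono (subset_univ _)
        have h2 : μ.real (Ioi w) ≤ μ.real univ := measureReal_mono (subset_univ _)
        have h3 : 0 ≤ ν.real (Ioi w) := measureReal_nonneg
        have h4 : 0 ≤ μ.real (Ioi w) := measureReal_nonneg
        have h5 : 0 ≤ δ * μ.real (Ioi w) := by positivity
        rw [indicator_of_mem (by exact hw)]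
        simp only [Pi.one_apply, mul_one]
        rw [abs_le]
        constructor <;> linarith
      · have h1 : dist (ν.real (Ioi w) / μ.real (Ioi w)) 1 < δ := (hA w (hBA.trans hw)).1
        have h4 := (hA w (hBA.trans hw)).2
        rw [indicator_of_notMem (by simpa using hw)]
        rw [Real.dist_eq, div_sub_one h4.ne', abs_div, abs_of_pos h4, div_lt_iff₀ h4] at h1
        linarith
    have hσB := (hσ B hB0).const_mul C
    have hlim := (hμ.const_mul δ).add hσB
    rw [mul_zero, add_zero] at hlim
    filter_upwards [hR, hlim.eventually (gt_mem_nhds (show δ * L < ε by linarith))] with x hx hlt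
    rw [Real.dist_eq, sub_zero, ← sub_div, abs_div, abs_of_pos hx, div_lt_iff₀ hx]
    rw [← mul_div_assoc, ← mul_div_assoc, ← add_div, div_lt_iff₀ hx] at hlt
    refine lt_of_le_of_lt ?_ hlt
    rw [← integral_sub (hint ν x) (hint μ x)]
    have hind : (fun z => (Iio B).indicator (1 : ℝ → ℝ) (x - z)) = (Ioi (x - B)).indicator 1 := by
      ext z
      simp only [indicator, mem_Iio, mem_Ioi, Pi.one_apply]
      congr 1
      exact propext sub_lt_comm
    have hi2 : Integrable (fun z => (Iio B).indicator (1 : ℝ → ℝ) (x - z)) σ := by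
      rw [hind]
      exact (integrable_const (1 : ℝ)).indicator measurableSet_Ioi
    calc |∫ z, (ν.real (Ioi (x - z)) - μ.real (Ioi (x - z))) ∂σ|
        ≤ ∫ z, |ν.real (Ioi (x - z)) - μ.real (Ioi (x - z))| ∂σ := abs_integral_le_integral_abs
      _ ≤ ∫ z, (δ * μ.real (Ioi (x - z)) + C * (Iio B).indicator 1 (x - z)) ∂σ := by
        refine integral_mono ((hint ν x).sub (hint μ x)).abs
          (((hint μ x).const_mul δ).add (hi2.const_mul C)) fun z => hpt _
      _ = δ * (∫ z, μ.real (Ioi (x - z)) ∂σ) + C * σ.real (Ioi (x - B)) := by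
        rw [integral_add ((hint μ x).const_mul δ) (hi2.const_mul C), integral_const_mul,
          integral_const_mul, hind, integral_indicator_one measurableSet_Ioi]
  have := hdiff.add hμ
  simpa using this

theorem intervalIntegrable_and_integral_rpow_mul_one_sub_rpow {a b : ℝ} (ha : 0 < a) (hb : 0 < b) :
    IntervalIntegrable (fun u : ℝ => u ^ (a - 1) * (1 - u) ^ (b - 1)) volume 0 1 ∧
      ∫ u in (0 : ℝ)..1, u ^ (a - 1) * (1 - u) ^ (b - 1) = Beta a b := by
  have hc : IntegrableOn (fun u : ℝ => (u : ℂ) ^ ((a : ℂ) - 1) * (1 - (u : ℂ)) ^ ((b : ℂ) - 1))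
      (Ioc 0 1) := by
    have := Complex.betaIntegral_convergent (u := a) (v := b) (by simpa) (by simpa)
    rwa [intervalIntegrable_iff_integrableOn_Ioc_of_le zero_le_one] at this
  have heq : EqOn (fun u : ℝ => RCLike.re
      ((u : ℂ) ^ ((a : ℂ) - 1) * (1 - (u : ℂ)) ^ ((b : ℂ) - 1)))
      (fun u => u ^ (a - 1) * (1 - u) ^ (b - 1)) (Ioc 0 1) := by
    intro u hu
    simp only
    norm_cast
    rw [← Complex.ofReal_cpow hu.1.le, ← Complex.ofReal_cpow (sub_nonneg.2 hu.2),
      RCLike.re_to_complex, Complex.re_mul_ofReal, Complex.ofReal_re]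
  constructor
  · rw [intervalIntegrable_iff_integrableOn_Ioc_of_le zero_le_one]
    exact (integrableOn_congr_fun heq measurableSet_Ioc).1 hc.re
  · rw [intervalIntegral.integral_of_le zero_le_one, ← setIntegral_congr_fun measurableSet_Ioc heq,
      integral_re hc]
    have := ProbabilityTheory.beta_eq_betaIntegralReal a b ha hb
    rw [Complex.betaIntegral, intervalIntegral.integral_of_le zero_le_one] at this
    exact this.symm

theorem tendsto_integral_regVar_mul {g₁ g₂ : ℝ → ℝ} {γ₁ γ₂ β₁ β₂ C₁ C₂ : ℝ}
    (hg₁ : Measurable g₁) (hg₂ : Measurable g₂) (hpos₁ : ∀ x, 0 < g₁ x) (hpos₂ : ∀ x, 0 < g₂ x)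
    (hrv₁ : ∀ t : ℝ, 0 < t → Tendsto (fun x => g₁ (x * t) / g₁ x) atTop (𝓝 (t ^ γ₁)))
    (hrv₂ : ∀ t : ℝ, 0 < t → Tendsto (fun x => g₂ (x * t) / g₂ x) atTop (𝓝 (t ^ γ₂)))
    (hγ₁ : -1 < γ₁) (hγ₂ : -1 < γ₂) (hβ₁ : -1 < β₁) (hβ₂ : -1 < β₂)
    (hP₁ : ∀ᶠ x in atTop, ∀ u, 0 < u → u ≤ 1 → g₁ (x * u) ≤ C₁ * u ^ β₁ * g₁ x)
    (hP₂ : ∀ᶠ x in atTop, ∀ u, 0 < u → u ≤ 1 → g₂ (x * u) ≤ C₂ * u ^ β₂ * g₂ x) :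
    Tendsto (fun x => ∫ u in (0 : ℝ)..1, g₁ (x * u) / g₁ x * (g₂ (x * (1 - u)) / g₂ x)) atTop
      (𝓝 (Beta (γ₁ + 1) (γ₂ + 1))) := by
  have hB := (intervalIntegrable_and_integral_rpow_mul_one_sub_rpow (neg_lt_iff_pos_add.1 hγ₁)
    (neg_lt_iff_pos_add.1 hγ₂)).2
  have hI := (intervalIntegrable_and_integral_rpow_mul_one_sub_rpow (neg_lt_iff_pos_add.1 hβ₁)
    (neg_lt_iff_pos_add.1 hβ₂)).1
  simp only [add_sub_cancel_right] at hB hI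
  have hne : ∀ᵐ u : ℝ, u ≠ 1 := by simp [ae_iff, measure_singleton]
  rw [← hB]
  apply intervalIntegral.tendsto_integral_filter_of_dominated_convergence
    (fun u => C₁ * C₂ * (u ^ β₁ * (1 - u) ^ β₂))
  · refine Eventually.of_forall fun x => Measurable.aestronglyMeasurable ?_
    have m1 : Measurable fun u => g₁ (x * u) := hg₁.comp (measurable_id.const_mul x)
    have m2 : Measurable fun u => g₂ (x * (1 - u)) :=
      hg₂.comp ((measurable_const.sub measurable_id).const_mul x)
    exact (m1.div_const _).mul (m2.div_const _)
  · filter_upwards [hP₁, hP₂] with x h1 h2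
    filter_upwards [hne] with u hu1 hu
    rw [uIoc_of_le zero_le_one] at hu
    have hu' : 0 < 1 - u := sub_pos.2 (lt_of_le_of_ne hu.2 hu1)
    have p1 := hpos₁ x
    have p2 := hpos₂ x
    have p3 := hpos₁ (x * u)
    have p4 := hpos₂ (x * (1 - u))
    rw [Real.norm_of_nonneg (by positivity)]
    have e1 := (div_le_iff₀ p1).2 (h1 u hu.1 hu.2)
    have e2 := (div_le_iff₀ p2).2 (h2 (1 - u) hu' (by linarith [hu.1]))
    calc _ ≤ (C₁ * u ^ β₁) * (C₂ * (1 - u) ^ β₂) :=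
          mul_le_mul e1 e2 (by positivity) (le_trans (by positivity) e1)
      _ = _ := by ring
  · exact hI.const_mul _
  · filter_upwards [hne] with u hu1 hu
    rw [uIoc_of_le zero_le_one] at hu
    exact (hrv₁ u hu.1).mul (hrv₂ (1 - u) (sub_pos.2 (lt_of_le_of_ne hu.2 hu1)))

section Tails

variable {T : ℝ → ℝ} {α γ : ℝ}

theorem tendsto_tail_add_div (hT : Measurable T) (hpos : ∀ x, 0 < T x)
    (hrv : ∀ t : ℝ, 0 < t → Tendsto
      (fun x => (Real.exp (α * (x * t)) * T (x * t)) / (Real.exp (α * x) * T x)) atTop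
      (𝓝 (t ^ γ))) {t : ℝ} (ht : 0 ≤ t) :
    Tendsto (fun x => T (x + t) / T x) atTop (𝓝 (Real.exp (-α * t))) := by
  have hgm : Measurable fun x => Real.exp (α * x) * T x := by fun_prop
  have h1 := (tendsto_add_div_of_regVar hgm
    (fun x => mul_pos (Real.exp_pos _) (hpos x)) hrv ht).const_mul (Real.exp (-α * t))
  rw [mul_one] at h1
  refine h1.congr fun x => ?_
  have := hpos x
  rw [mul_add, Real.exp_add, neg_mul, Real.exp_neg]
  field_simp

theorem tendsto_tail_sub_div (h : ∀ t, 0 ≤ t → Tendsto (fun x => T (x + t) / T x) atTop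
      (𝓝 (Real.exp (-α * t)))) {A : ℝ} (hA : 0 ≤ A) :
    Tendsto (fun x => T (x - A) / T x) atTop (𝓝 (Real.exp (α * A))) := by
  have h1 := ((h A hA).comp (tendsto_atTop_add_const_right atTop (-A) tendsto_id)).inv₀
    (Real.exp_pos _).ne'
  rw [neg_mul, Real.exp_neg, inv_inv] at h1
  refine h1.congr fun x => ?_
  simp [sub_eq_add_neg]

end Tails

/-- The convolution tail when one factor is replaced by the measure with density `α` times
its own tail. -/
theorem tendsto_integral_tail_mul_tail_div {T₁ T₂ : ℝ → ℝ} {α γ₁ γ₂ : ℝ} (hα : 0 < α)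
    (hγ₁ : -1 < γ₁) (hγ₂ : -1 < γ₂) (hpos₁ : ∀ x, 0 < T₁ x) (hpos₂ : ∀ x, 0 < T₂ x)
    (hanti₁ : Antitone T₁) (hanti₂ : Antitone T₂) (hle₁ : ∀ x, T₁ x ≤ 1) (hle₂ : ∀ x, T₂ x ≤ 1)
    (hrv₁ : ∀ t : ℝ, 0 < t → Tendsto
      (fun x => (Real.exp (α * (x * t)) * T₁ (x * t)) / (Real.exp (α * x) * T₁ x)) atTop
      (𝓝 (t ^ γ₁)))
    (hrv₂ : ∀ t : ℝ, 0 < t → Tendsto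
      (fun x => (Real.exp (α * (x * t)) * T₂ (x * t)) / (Real.exp (α * x) * T₂ x)) atTop
      (𝓝 (t ^ γ₂))) :
    Tendsto (fun x => x * (Real.exp (α * x) * T₁ x)) atTop atTop ∧
    Tendsto (fun x => (∫ y in Ioi 0, α * T₁ y * T₂ (x - y)) /
      (α * Real.exp (α * x) * x * T₁ x * T₂ x)) atTop (𝓝 (Beta (γ₁ + 1) (γ₂ + 1))) := by
  have hm₁ := hanti₁.measurable
  have hm₂ := hanti₂.measurable
  have hgm₁ : Measurable fun x => Real.exp (α * x) * T₁ x := by fun_prop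
  have hgm₂ : Measurable fun x => Real.exp (α * x) * T₂ x := by fun_prop
  have hbd : ∀ T : ℝ → ℝ, (∀ x, 0 < T x) → (∀ x, T x ≤ 1) →
      ∀ r : ℝ, ∃ M, ∀ y ≤ r, Real.exp (α * y) * T y ≤ M := fun T hp hl r =>
    ⟨Real.exp (α * r), fun y hy => by
      rw [← mul_one (Real.exp (α * r))]
      exact mul_le_mul (Real.exp_le_exp.2 (by gcongr)) (hl y) (hp y).le (Real.exp_pos _).le⟩
  have hgp₁ : ∀ x, 0 < Real.exp (α * x) * T₁ x := fun x => mul_pos (Real.exp_pos _) (hpos₁ x)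
  have hgp₂ : ∀ x, 0 < Real.exp (α * x) * T₂ x := fun x => mul_pos (Real.exp_pos _) (hpos₂ x)
  obtain ⟨β₁, C₁, hβ₁, hC₁, hP₁⟩ := exists_potter_bound hgm₁ hgp₁ (hbd _ hpos₁ hle₁) hrv₁ hγ₁
  obtain ⟨β₂, C₂, hβ₂, hC₂, hP₂⟩ := exists_potter_bound hgm₂ hgp₂ (hbd _ hpos₂ hle₂) hrv₂ hγ₂
  refine ⟨tendsto_id_mul_atTop_of_potter hgp₁ hβ₁ hC₁ hP₁, ?_⟩
  have hmain := tendsto_integral_regVar_mul hgm₁ hgm₂ hgp₁ hgp₂ hrv₁ hrv₂ hγ₁ hγ₂ hβ₁ hβ₂ hP₁ hP₂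
  obtain ⟨hint, htail⟩ := tendsto_integral_tail_div hα hpos₁ hanti₁
    fun t ht => tendsto_tail_add_div hm₁ hpos₁ hrv₁ ht
  have hatTop₂ := tendsto_id_mul_atTop_of_potter hgp₂ hβ₂ hC₂ hP₂
  have hint2 : ∀ x a, IntegrableOn (fun y => α * T₁ y * T₂ (x - y)) (Ioi a) := by
    intro x a
    refine ((hint a).const_mul α).mono' ?_ (Eventually.of_forall fun y => ?_)
    · have : Measurable fun y => T₂ (x - y) := hm₂.comp (measurable_const.sub measurable_id)
      exact ((hm₁.const_mul α).mul this).aestronglyMeasurable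
    · have p1 := hpos₁ y
      have p2 := hpos₂ (x - y)
      rw [Real.norm_of_nonneg (by positivity)]
      exact mul_le_of_le_one_right (by positivity) (hle₂ _)
  have hrest : Tendsto (fun x => (∫ y in Ioi x, α * T₁ y * T₂ (x - y)) /
      (α * Real.exp (α * x) * x * T₁ x * T₂ x)) atTop (𝓝 0) := by
    have hlim := (htail.mul (hatTop₂.inv_tendsto_atTop)).const_mul α⁻¹
    rw [mul_zero, mul_zero] at hlim
    refine squeeze_zero' ?_ ?_ hlim
    · filter_upwards [eventually_gt_atTop 0] with x hx
      have p1 := hpos₁ x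
      have p2 := hpos₂ x
      refine div_nonneg (integral_nonneg fun y => ?_) (by positivity)
      have p3 := hpos₁ y
      have p4 := hpos₂ (x - y)
      positivity
    · filter_upwards [eventually_gt_atTop 0] with x hx
      have p1 := hpos₁ x
      have p2 := hpos₂ x
      have h1 : (∫ y in Ioi x, α * T₁ y * T₂ (x - y)) ≤ ∫ y in Ioi x, α * T₁ y :=
        integral_mono (hint2 x x) ((hint x).const_mul α) fun y =>
          mul_le_of_le_one_right (mul_pos hα (hpos₁ y)).le (hle₂ _)
      calc _ ≤ (∫ y in Ioi x, α * T₁ y) / (α * Real.exp (α * x) * x * T₁ x * T₂ x) := by gcongr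
        _ = _ := by simp only [Pi.inv_apply]; field_simp
  have hsum := hmain.add hrest
  rw [add_zero] at hsum
  refine hsum.congr' ?_
  filter_upwards [eventually_gt_atTop 0] with x hx
  have p1 := hpos₁ x
  have p2 := hpos₂ x
  have hsplit : (∫ y in Ioi 0, α * T₁ y * T₂ (x - y)) =
      (∫ y in (0 : ℝ)..x, α * T₁ y * T₂ (x - y)) + ∫ y in Ioi x, α * T₁ y * T₂ (x - y) := by
    rw [intervalIntegral.integral_of_le hx.le, ← setIntegral_union Ioc_disjoint_Ioi_same
      measurableSet_Ioi ((hint2 x 0).mono_set Ioc_subset_Ioi_self) (hint2 x x),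
      Ioc_union_Ioi_eq_Ioi hx.le]
  have hscale := intervalIntegral.mul_integral_comp_mul_left
    (f := fun y => α * T₁ y * T₂ (x - y)) (a := 0) (b := 1) x
  rw [mul_zero, mul_one] at hscale
  rw [hsplit, add_div, ← hscale]
  congr 1
  rw [mul_div_assoc, ← intervalIntegral.integral_div, ← intervalIntegral.integral_const_mul]
  refine intervalIntegral.integral_congr fun u _ => ?_
  have e : Real.exp (α * (x * (1 - u))) = Real.exp (α * x) / Real.exp (α * (x * u)) := by
    rw [← Real.exp_sub]; congr 1; ring
  rw [e, show x * (1 - u) = x - x * u by ring]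
  have := Real.exp_pos (α * (x * u))
  field_simp

/-- The measure on `(0, ∞)` with density `α T`, and its tails. -/
theorem exists_measure_integral_tail {T : ℝ → ℝ} {α : ℝ} (hα : 0 < α) (hT : Measurable T)
    (hpos : ∀ x, 0 < T x) (hint : IntegrableOn T (Ioi 0)) :
    ∃ ν : Measure ℝ, IsFiniteMeasure ν ∧
      (∀ x, 0 ≤ x → ν.real (Ioi x) = ∫ y in Ioi x, α * T y) ∧
      ∀ φ : ℝ → ℝ, ∫ y, φ y ∂ν = ∫ y in Ioi 0, α * T y * φ y := by
  have hm : Measurable fun y => ENNReal.ofReal (α * T y) := (hT.const_mul α).ennreal_ofReal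
  have hfin := isFiniteMeasure_withDensity_ofReal (hint.const_mul α).2
  have hform : ∀ φ : ℝ → ℝ, ∫ y, φ y ∂((volume.restrict (Ioi 0)).withDensity
      fun y => ENNReal.ofReal (α * T y)) = ∫ y in Ioi 0, α * T y * φ y := by
    intro φ
    rw [integral_withDensity_eq_integral_toReal_smul hm
      (Eventually.of_forall fun y => ENNReal.ofReal_lt_top)]
    refine integral_congr_ae (Eventually.of_forall fun y => ?_)
    simp [ENNReal.toReal_ofReal (mul_pos hα (hpos y)).le]
  refine ⟨_, hfin, fun x hx => ?_, hform⟩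
  rw [← integral_indicator_one measurableSet_Ioi, hform]
  have h1 : (fun y => α * T y * (Ioi x).indicator 1 y) = (Ioi x).indicator fun y => α * T y := by
    ext y
    by_cases hy : y ∈ Ioi x <;> simp [hy]
  rw [h1, setIntegral_indicator measurableSet_Ioi, Ioi_inter_Ioi, sup_of_le_right hx]

theorem tendsto_conv_tail_div_of_regVar (μ₁ μ₂ : Measure ℝ)
    [IsProbabilityMeasure μ₁] [IsProbabilityMeasure μ₂]
    {α γ₁ γ₂ : ℝ} (hα : 0 < α) (hγ₁ : -1 < γ₁) (hγ₂ : -1 < γ₂)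
    (hpos₁ : ∀ x, 0 < μ₁.real (Ioi x)) (hpos₂ : ∀ x, 0 < μ₂.real (Ioi x))
    (hrv₁ : ∀ t : ℝ, 0 < t → Tendsto (fun x => (Real.exp (α * (x * t)) * μ₁.real (Ioi (x * t))) /
      (Real.exp (α * x) * μ₁.real (Ioi x))) atTop (𝓝 (t ^ γ₁)))
    (hrv₂ : ∀ t : ℝ, 0 < t → Tendsto (fun x => (Real.exp (α * (x * t)) * μ₂.real (Ioi (x * t))) /
      (Real.exp (α * x) * μ₂.real (Ioi x))) atTop (𝓝 (t ^ γ₂))) :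
    Tendsto (fun x => (μ₁.prod μ₂).real {p : ℝ × ℝ | x < p.1 + p.2} /
      (α * Real.exp (α * x) * x * μ₁.real (Ioi x) * μ₂.real (Ioi x))) atTop
      (𝓝 (Beta (γ₁ + 1) (γ₂ + 1))) := by
  have hanti : ∀ (κ : Measure ℝ) [IsFiniteMeasure κ], Antitone fun x => κ.real (Ioi x) :=
    fun κ _ a b hab => measureReal_mono (Ioi_subset_Ioi hab)
  obtain ⟨hatTop, hlim⟩ := tendsto_integral_tail_mul_tail_div hα hγ₁ hγ₂ hpos₁ hpos₂
    (hanti μ₁) (hanti μ₂) (fun _ => measureReal_le_one) (fun _ => measureReal_le_one) hrv₁ hrv₂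
  have hlong₁ : ∀ t, 0 ≤ t → Tendsto (fun x => μ₁.real (Ioi (x + t)) / μ₁.real (Ioi x)) atTop
      (𝓝 (Real.exp (-α * t))) := fun t ht =>
    tendsto_tail_add_div (hanti μ₁).measurable hpos₁ hrv₁ ht
  have hlong₂ : ∀ t, 0 ≤ t → Tendsto (fun x => μ₂.real (Ioi (x + t)) / μ₂.real (Ioi x)) atTop
      (𝓝 (Real.exp (-α * t))) := fun t ht =>
    tendsto_tail_add_div (hanti μ₂).measurable hpos₂ hrv₂ ht
  obtain ⟨hint, htail⟩ := tendsto_integral_tail_div hα hpos₁ (hanti μ₁) hlong₁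
  obtain ⟨ν, hν, hνtail, hνint⟩ :=
    exists_measure_integral_tail hα (hanti μ₁).measurable hpos₁ (hint 0)
  simp only [measureReal_prod_lt_add]
  refine tendsto_conv_tail_div_of_tail_equiv (μ := ν) ?_ ?_ ?_ ?_
  · filter_upwards [eventually_gt_atTop 0] with x hx
    have p1 := hpos₁ x
    have p2 := hpos₂ x
    positivity
  · have h1 := htail.inv₀ one_ne_zero
    rw [inv_one] at h1
    refine h1.congr' ?_
    filter_upwards [eventually_ge_atTop 0] with x hx
    rw [hνtail x hx, inv_div]
  · intro A hA
    have h1 := ((tendsto_tail_sub_div (T := fun x => μ₂.real (Ioi x)) hlong₂ hA).mul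
      hatTop.inv_tendsto_atTop).const_mul α⁻¹
    rw [mul_zero, mul_zero] at h1
    refine h1.congr' ?_
    filter_upwards [eventually_gt_atTop 0] with x hx
    have p1 := hpos₁ x
    have p2 := hpos₂ x
    simp only [Pi.inv_apply]
    field_simp
  · refine hlim.congr fun x => ?_
    rw [← measureReal_prod_lt_add, measureReal_prod_lt_add', hνint]

/-- Tails asymptotic to `e^{-αx} f(x)` with `f` regularly varying are positive, and the tilted
tail is regularly varying and equivalent to `f`. -/
theorem tilted_tail_of_isEquivalent (μ : Measure ℝ) [IsFiniteMeasure μ] {α γ : ℝ} {f : ℝ → ℝ}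
    (hev : ∀ᶠ x in atTop, 0 < f x)
    (hrv : ∀ t : ℝ, 0 < t → Tendsto (fun x => f (x * t) / f x) atTop (𝓝 (t ^ γ)))
    (htail : (fun x => μ.real (Ioi x)) ~[atTop] fun x => Real.exp (-α * x) * f x) :
    (∀ x, 0 < μ.real (Ioi x)) ∧
      Tendsto (fun x => (Real.exp (α * x) * μ.real (Ioi x)) / f x) atTop (𝓝 1) ∧
      ∀ t : ℝ, 0 < t → Tendsto (fun x => (Real.exp (α * (x * t)) * μ.real (Ioi (x * t))) /
        (Real.exp (α * x) * μ.real (Ioi x))) atTop (𝓝 (t ^ γ)) := by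
  have hratio : Tendsto (fun x => (Real.exp (α * x) * μ.real (Ioi x)) / f x) atTop (𝓝 1) := by
    have hne : ∀ᶠ x in atTop, Real.exp (-α * x) * f x ≠ 0 := by
      filter_upwards [hev] with x hx
      positivity
    refine ((isEquivalent_iff_tendsto_one hne).1 htail).congr fun x => ?_
    rw [Pi.div_apply, neg_mul, Real.exp_neg]
    field_simp
  refine ⟨fun x => ?_, hratio, fun t ht => ?_⟩
  · obtain ⟨y, hy, hxy⟩ :=
      ((hratio.eventually (lt_mem_nhds zero_lt_one)).and (eventually_ge_atTop x)).exists
    have h0 : μ.real (Ioi y) ≠ 0 := fun h => by simp [h] at hy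
    exact (lt_of_le_of_ne measureReal_nonneg h0.symm).trans_le
      (measureReal_mono (Ioi_subset_Ioi hxy))
  · have hxt : Tendsto (fun x : ℝ => x * t) atTop atTop := tendsto_id.atTop_mul_const ht
    have h1 := ((hratio.comp hxt).mul (hrv t ht)).mul (hratio.inv₀ one_ne_zero)
    rw [one_mul, inv_one, mul_one] at h1
    refine h1.congr' ?_
    filter_upwards [hev, hxt.eventually hev] with x hx hx'
    simp only [Function.comp]
    field_simp

end ConvolutionTail

/-- For independent `Y₁, Y₂` with non-lattice distributions `Vᵢ ∈ 𝓛₁₁(α)` where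
`V̄ᵢ(x) ∼ e^{-αx} fᵢ(x)`, `fᵢ` regularly varying of index `γᵢ > -1`,
`P(Y₁+Y₂ > x) ∼ B(γ₁+1, γ₂+1) α e^{-αx} x f₁(x) f₂(x)`. -/
theorem conv_tail_semiRegVar (μ₁ μ₂ : Measure ℝ)
    [IsProbabilityMeasure μ₁] [IsProbabilityMeasure μ₂]
    (α γ₁ γ₂ : ℝ) (hα : 0 < α) (hγ₁ : -1 < γ₁) (hγ₂ : -1 < γ₂) (f₁ f₂ : ℝ → ℝ)
    (hnl1 : ¬ IsLatticeMeasure μ₁) (hnl2 : ¬ IsLatticeMeasure μ₂)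
    (hfnn₁ : ∀ x, 0 ≤ f₁ x) (hfnn₂ : ∀ x, 0 ≤ f₂ x)
    (hlb₁ : ∀ r : ℝ, ∃ C : ℝ, ∀ x ∈ Set.Icc (0:ℝ) r, f₁ x ≤ C)
    (hlb₂ : ∀ r : ℝ, ∃ C : ℝ, ∀ x ∈ Set.Icc (0:ℝ) r, f₂ x ≤ C)
    (hev₁ : ∀ᶠ x in atTop, 0 < f₁ x) (hev₂ : ∀ᶠ x in atTop, 0 < f₂ x)
    (hrv₁ : ∀ t : ℝ, 0 < t → Tendsto (fun x => f₁ (x * t) / f₁ x) atTop (nhds (t ^ γ₁)))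
    (hrv₂ : ∀ t : ℝ, 0 < t → Tendsto (fun x => f₂ (x * t) / f₂ x) atTop (nhds (t ^ γ₂)))
    (htail₁ : (fun x => (μ₁ (Set.Ioi x)).toReal) ~[atTop]
      (fun x => Real.exp (-α * x) * f₁ x))
    (htail₂ : (fun x => (μ₂ (Set.Ioi x)).toReal) ~[atTop]
      (fun x => Real.exp (-α * x) * f₂ x)) :
    (fun x => ((μ₁.prod μ₂) {p : ℝ × ℝ | x < p.1 + p.2}).toReal) ~[atTop]
      (fun x => Beta (γ₁ + 1) (γ₂ + 1) * α * Real.exp (-α * x) * x * f₁ x * f₂ x) := by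
  obtain ⟨hpos₁, hratio₁, hg₁⟩ := tilted_tail_of_isEquivalent μ₁ hev₁ hrv₁ htail₁
  obtain ⟨hpos₂, hratio₂, hg₂⟩ := tilted_tail_of_isEquivalent μ₂ hev₂ hrv₂ htail₂
  have hlim := tendsto_conv_tail_div_of_regVar μ₁ μ₂ hα hγ₁ hγ₂ hpos₁ hpos₂ hg₁ hg₂
  have hB : 0 < Beta (γ₁ + 1) (γ₂ + 1) :=
    ProbabilityTheory.beta_pos (neg_lt_iff_pos_add.1 hγ₁) (neg_lt_iff_pos_add.1 hγ₂)
  have hne : ∀ᶠ x in atTop,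
      Beta (γ₁ + 1) (γ₂ + 1) * α * Real.exp (-α * x) * x * f₁ x * f₂ x ≠ 0 := by
    filter_upwards [hev₁, hev₂, eventually_gt_atTop 0] with x h1 h2 hx
    positivity
  refine (isEquivalent_iff_tendsto_one hne).2 ?_
  have h := ((hlim.mul hratio₁).mul hratio₂).div_const (Beta (γ₁ + 1) (γ₂ + 1))
  rw [mul_one, mul_one, div_self hB.ne'] at h
  refine h.congr' ?_
  filter_upwards [hev₁, hev₂, eventually_gt_atTop 0] with x h1 h2 hx
  have p1 := hpos₁ x
  have p2 := hpos₂ x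
  rw [Pi.div_apply, neg_mul, Real.exp_neg, ← measureReal_def]
  field_simp
end

section
/- Let Y₁, Y₂ be independent with non-lattice distributions Vᵢ ∈ 𝓛₁₁(α) where V̄ᵢ(x) ∼ e^{−αx} fᵢ(x), α > 0, fᵢ ∈ 𝓡_{−1}, fᵢ locally bounded, and ∫₀^∞ fᵢ(y) dy = ∞. Then P(Y₁+Y₂ > x) ∼ α e^{−αx} ( f₁(x) f₂^I(x) + f₂(x) f₁^I(x) ) as x → ∞, where f^I(x) = ∫₀ˣ f(y) dy. -/
open Filter MeasureTheory Asymptotics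

namespace RegVarTail

open Set Topology intervalIntegral

/-- Uniform convergence theorem for measurable functions with vanishing increments at infinity. -/
theorem eventually_abs_sub_lt_of_tendsto_sub {k : ℝ → ℝ} (hk : Measurable k)
    (h : ∀ u : ℝ, Tendsto (fun x => k (x + u) - k x) atTop (𝓝 0)) {ε : ℝ} (hε : 0 < ε) :
    ∀ᶠ x in atTop, ∀ u ∈ Icc (0 : ℝ) 1, |k (x + u) - k x| < ε := by
  have hmeas : ∀ x c, Measurable fun u => min 1 |k (x + u) - c| := fun x c => by fun_prop
  have hint : ∀ x c a b, IntervalIntegrable (fun u => min 1 |k (x + u) - c|) volume a b := by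
    intro x c a b
    refine (intervalIntegrable_const (c := (1 : ℝ))).mono_fun
      (hmeas x c).aestronglyMeasurable (Eventually.of_forall fun u => ?_)
    simp only [Real.norm_eq_abs, abs_one]
    rw [abs_of_nonneg (by positivity)]
    exact min_le_left _ _
  have hD : Tendsto (fun x => ∫ u in (0 : ℝ)..2, min 1 |k (x + u) - k x|) atTop (𝓝 0) := by
    have := tendsto_integral_filter_of_dominated_convergence (μ := volume) (a := 0) (b := 2)
      (F := fun x u => min 1 |k (x + u) - k x|) (f := fun _ => (0 : ℝ)) (l := atTop) (fun _ => 1)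
      (Eventually.of_forall fun x => (hmeas x _).aestronglyMeasurable)
      (Eventually.of_forall fun x => Eventually.of_forall fun u _ => by
        rw [Real.norm_eq_abs, abs_of_nonneg (by positivity)]
        exact min_le_left _ _)
      intervalIntegrable_const
      (Eventually.of_forall fun u _ => by
        simpa using (tendsto_const_nhds (x := (1 : ℝ))).min (h u).abs)
    simpa using this
  obtain ⟨X, hX⟩ := eventually_atTop.1
    (hD.eventually_lt_const (show (0 : ℝ) < min 1 ε / 2 by positivity))
  filter_upwards [eventually_ge_atTop X] with x hx u hu
  have h1 : ∫ w in (1 : ℝ)..2, min 1 |k (x + w) - k x| ≤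
      ∫ w in (0 : ℝ)..2, min 1 |k (x + w) - k x| :=
    integral_mono_interval (by norm_num) (by norm_num) le_rfl
      (Eventually.of_forall fun _ => by positivity) (hint _ _ _ _)
  have h2 : ∫ w in (1 : ℝ)..2, min 1 |k (x + w) - k (x + u)| ≤
      ∫ w in (0 : ℝ)..2, min 1 |k (x + u + w) - k (x + u)| := by
    have : ∫ w in (1 : ℝ)..2, min 1 |k (x + w) - k (x + u)| =
        ∫ w in (1 - u)..(2 - u), min 1 |k (x + u + w) - k (x + u)| := by
      rw [← integral_comp_sub_right (fun w => min 1 |k (x + u + w) - k (x + u)|) u]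
      refine integral_congr fun w _ => ?_
      rw [show x + u + (w - u) = x + w by ring]
    rw [this]
    exact integral_mono_interval (by linarith [hu.2]) (by linarith) (by linarith [hu.1])
      (Eventually.of_forall fun _ => by positivity) (hint _ _ _ _)
  have h3 : min 1 |k (x + u) - k x| ≤ ∫ w in (1 : ℝ)..2,
      (min 1 |k (x + w) - k x| + min 1 |k (x + w) - k (x + u)|) := by
    have : min 1 |k (x + u) - k x| = ∫ w in (1 : ℝ)..2, min 1 |k (x + u) - k x| := by
      rw [intervalIntegral.integral_const]; norm_num
    rw [this]
    refine integral_mono (by norm_num) intervalIntegrable_const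
      ((hint _ _ _ _).add (hint _ _ _ _)) fun w => ?_
    dsimp only
    have htri := abs_sub_le (k (x + u)) (k (x + w)) (k x)
    rw [abs_sub_comm (k (x + u)) (k (x + w))] at htri
    have hp1 := abs_nonneg (k (x + w) - k x)
    have hp2 := abs_nonneg (k (x + w) - k (x + u))
    rcases le_total 1 |k (x + w) - k x| with ha | ha <;>
    rcases le_total 1 |k (x + w) - k (x + u)| with hb | hb <;>
    simp only [min_eq_left ha, min_eq_right ha, min_eq_left hb, min_eq_right hb] <;>
    [skip; skip; skip; exact (min_le_right _ _).trans (by linarith)] <;>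
    exact (min_le_left _ _).trans (by linarith)
  rw [integral_add (hint _ _ _ _) (hint _ _ _ _)] at h3
  have h4 : min 1 |k (x + u) - k x| < min 1 ε := by
    linarith [hX x hx, hX (x + u) (by linarith [hu.1])]
  have h5 : |k (x + u) - k x| < 1 := by
    by_contra hc
    rw [min_eq_left (not_lt.1 hc)] at h4
    exact absurd (min_le_left 1 ε) (not_le.2 h4)
  rw [min_eq_right h5.le] at h4
  exact h4.trans_le (min_le_right _ _)

/-- Uniform convergence theorem for positive measurable slowly varying functions. -/
theorem eventually_slowly_varying {L : ℝ → ℝ} (hL : Measurable L) (hpos : ∀ x, 0 < x → 0 < L x)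
    (h : ∀ t, 0 < t → Tendsto (fun x => L (x * t) / L x) atTop (𝓝 1)) {ε : ℝ} (hε : 0 < ε) :
    ∀ᶠ x in atTop, ∀ y ∈ Icc (x / 2) x, (1 - ε) * L x ≤ L y ∧ L y ≤ (1 + ε) * L x := by
  have hk : Measurable fun s => Real.log (L (Real.exp s)) := by fun_prop
  have hlim : ∀ u : ℝ, Tendsto (fun s => Real.log (L (Real.exp (s + u))) -
      Real.log (L (Real.exp s))) atTop (𝓝 0) := by
    intro u
    have h1 := ((h (Real.exp u) (Real.exp_pos u)).comp Real.tendsto_exp_atTop).log one_ne_zero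
    rw [Real.log_one] at h1
    refine h1.congr fun s => ?_
    simp only [Function.comp, ← Real.exp_add]
    exact Real.log_div (hpos _ (Real.exp_pos _)).ne' (hpos _ (Real.exp_pos _)).ne'
  obtain ⟨S, hS⟩ := eventually_atTop.1
    (eventually_abs_sub_lt_of_tendsto_sub hk hlim (Real.log_pos (by linarith : 1 < 1 + ε)))
  filter_upwards [eventually_ge_atTop (2 * Real.exp S)] with x hx y hy
  have hS0 := Real.exp_pos S
  have hy0 : 0 < y := by linarith [hy.1]
  have hx0 : 0 < x := hy0.trans_le hy.2
  have hSy : S ≤ Real.log y := by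
    rw [Real.le_log_iff_exp_le hy0]; linarith [hy.1]
  have hu0 : 0 ≤ Real.log x - Real.log y := sub_nonneg.2 (Real.log_le_log hy0 hy.2)
  have hu1 : Real.log x - Real.log y ≤ 1 := by
    have : Real.log x ≤ Real.log 2 + Real.log y := by
      rw [← Real.log_mul two_ne_zero hy0.ne']
      exact Real.log_le_log hx0 (by linarith [hy.1])
    linarith [Real.log_two_lt_d9]
  have key := hS _ hSy _ ⟨hu0, hu1⟩
  simp only [add_sub_cancel, Real.exp_log hx0, Real.exp_log hy0] at key
  have hLx := hpos x hx0
  have hLy := hpos y hy0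
  rw [abs_lt] at key
  constructor
  · have : L x ≤ (1 + ε) * L y := by
      rw [← Real.log_le_log_iff hLx (by positivity), Real.log_mul (by positivity) hLy.ne']
      linarith
    by_cases hε1 : ε < 1
    · have := mul_le_mul_of_nonneg_left this (sub_nonneg.2 hε1.le)
      nlinarith [mul_nonneg (sq_nonneg ε) hLy.le]
    · nlinarith
  · rw [← Real.log_le_log_iff hLy (by positivity), Real.log_mul (by positivity) hLx.ne']
    linarith

/-- Integration preserves `=o` when the primitive of the dominating function diverges. -/
theorem isLittleO_primitive {u v : ℝ → ℝ} (hu : ∀ x, 0 ≤ x → IntervalIntegrable u volume 0 x)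
    (hv : ∀ x, 0 ≤ x → IntervalIntegrable v volume 0 x) (hv0 : ∀ x, 0 ≤ x → 0 ≤ v x)
    (huv : u =o[atTop] v)
    (hdiv : Tendsto (fun x => ∫ t in (0 : ℝ)..x, v t) atTop atTop) :
    (fun x => ∫ t in (0 : ℝ)..x, u t) =o[atTop] fun x => ∫ t in (0 : ℝ)..x, v t := by
  rw [isLittleO_iff]
  intro c hc
  obtain ⟨X, hX⟩ := eventually_atTop.1
    ((isLittleO_iff.1 huv (half_pos hc)).and (eventually_ge_atTop 0))
  have hX0 := (hX X le_rfl).2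
  filter_upwards [eventually_ge_atTop X,
    hdiv.eventually_ge_atTop (2 / c * |∫ t in (0 : ℝ)..X, u t|)] with x hx hK
  have hx0 := hX0.trans hx
  have hvX : ∫ t in X..x, v t ≤ ∫ t in (0 : ℝ)..x, v t :=
    integral_mono_interval hX0 hx le_rfl
      ((ae_restrict_mem measurableSet_Ioc).mono fun t ht => hv0 t ht.1.le) (hv x hx0)
  have huX : |∫ t in X..x, u t| ≤ ∫ t in X..x, c / 2 * v t := by
    rw [← Real.norm_eq_abs]
    refine norm_integral_le_of_norm_le hx (Eventually.of_forall fun t ht => ?_)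
      (((hv X hX0).symm.trans (hv x hx0)).const_mul _)
    simpa [abs_of_nonneg (hv0 t (hX0.trans ht.1.le))] using (hX t ht.1.le).1
  rw [intervalIntegral.integral_const_mul] at huX
  rw [← integral_add_adjacent_intervals (hu X hX0) ((hu X hX0).symm.trans (hu x hx0))]
  have hV0 : 0 ≤ ∫ t in (0 : ℝ)..x, v t :=
    integral_nonneg hx0 fun t ht => hv0 t ht.1
  rw [Real.norm_eq_abs, Real.norm_eq_abs, abs_of_nonneg hV0]
  have h1 := abs_add_le (∫ t in (0 : ℝ)..X, u t) (∫ t in X..x, u t)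
  have h2 : |∫ t in (0 : ℝ)..X, u t| ≤ c / 2 * ∫ t in (0 : ℝ)..x, v t := by
    have := mul_le_mul_of_nonneg_left hK (half_pos hc).le
    calc _ = c / 2 * (2 / c * |∫ t in (0 : ℝ)..X, u t|) := by field_simp
      _ ≤ _ := this
  have h3 := mul_le_mul_of_nonneg_left hvX (half_pos hc).le
  linarith

theorem isEquivalent_primitive {u v : ℝ → ℝ} (hu : ∀ x, 0 ≤ x → IntervalIntegrable u volume 0 x)
    (hv : ∀ x, 0 ≤ x → IntervalIntegrable v volume 0 x) (hv0 : ∀ x, 0 ≤ x → 0 ≤ v x)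
    (huv : u ~[atTop] v)
    (hdiv : Tendsto (fun x => ∫ t in (0 : ℝ)..x, v t) atTop atTop) :
    (fun x => ∫ t in (0 : ℝ)..x, u t) ~[atTop] fun x => ∫ t in (0 : ℝ)..x, v t := by
  refine (isLittleO_primitive (fun x hx => (hu x hx).sub (hv x hx)) hv hv0 huv hdiv).congr'
    ?_ EventuallyEq.rfl
  filter_upwards [eventually_ge_atTop 0] with x hx
  simp only [Pi.sub_apply]
  exact integral_sub (hu x hx) (hv x hx)

/-- Positive measurable functions, regularly varying of index `-1`, with divergent primitive. -/
structure IsRegVarNegOne (g : ℝ → ℝ) : Prop where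
  measurable : Measurable g
  pos : ∀ x, 0 < g x
  intervalIntegrable : ∀ a b, IntervalIntegrable g volume a b
  tendsto_div : ∀ t, 0 < t → Tendsto (fun x => g (x * t) / g x) atTop (𝓝 t⁻¹)
  tendsto_primitive : Tendsto (fun x => ∫ t in (0 : ℝ)..x, g t) atTop atTop

namespace IsRegVarNegOne

variable {g : ℝ → ℝ}

theorem tendsto_mul_self_div (hg : IsRegVarNegOne g) {t : ℝ} (ht : 0 < t) :
    Tendsto (fun x => x * t * g (x * t) / (x * g x)) atTop (𝓝 1) := by
  have := (hg.tendsto_div t ht).const_mul t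
  rw [mul_inv_cancel₀ ht.ne'] at this
  refine this.congr' ?_
  filter_upwards [eventually_gt_atTop 0] with x hx
  have := (hg.pos x).ne'
  field_simp

theorem eventually_slowly_varying (hg : IsRegVarNegOne g) {ε : ℝ} (hε : 0 < ε) :
    ∀ᶠ x in atTop, ∀ y ∈ Icc (x / 2) x,
      (1 - ε) * (x * g x) ≤ y * g y ∧ y * g y ≤ (1 + ε) * (x * g x) :=
  RegVarTail.eventually_slowly_varying (L := fun x => x * g x) (measurable_id.mul hg.measurable)
    (fun x hx => mul_pos hx (hg.pos x)) (fun _ ht => hg.tendsto_mul_self_div ht) hε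

theorem primitive_mono (hg : IsRegVarNegOne g) : Monotone fun x => ∫ t in (0 : ℝ)..x, g t := by
  intro a b hab
  dsimp only
  rw [← sub_nonneg, integral_interval_sub_left (hg.intervalIntegrable _ _)
    (hg.intervalIntegrable _ _)]
  exact integral_nonneg hab fun t _ => (hg.pos t).le

theorem eventually_dyadic_bounds (hg : IsRegVarNegOne g) :
    ∀ᶠ x in atTop, x * g x / 4 ≤ (∫ t in (0 : ℝ)..x, g t) - ∫ t in (0 : ℝ)..x / 2, g t ∧
      (∫ t in (0 : ℝ)..x, g t) - ∫ t in (0 : ℝ)..x / 2, g t ≤ 2 * (x * g x) := by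
  filter_upwards [hg.eventually_slowly_varying one_half_pos, eventually_gt_atTop 0] with x hx hx0
  rw [integral_interval_sub_left (hg.intervalIntegrable _ _) (hg.intervalIntegrable _ _)]
  have hgx := hg.pos x
  have hle : x / 2 ≤ x := by linarith
  constructor
  · have := integral_mono_on hle (intervalIntegrable_const (c := g x / 2))
      (hg.intervalIntegrable (x / 2) x) fun y hy => by
        have := (hx y hy).1
        have hgy := hg.pos y
        have h2 : y * g y ≤ x * g y := mul_le_mul_of_nonneg_right hy.2 hgy.le
        have h3 : x * (g x / 2) ≤ x * g y := by linarith
        exact le_of_mul_le_mul_left h3 hx0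
    rw [intervalIntegral.integral_const, smul_eq_mul] at this
    linarith
  · have := integral_mono_on hle (hg.intervalIntegrable (x / 2) x)
      (intervalIntegrable_const (c := 4 * g x)) fun y hy => by
        have := (hx y hy).2
        have hgy := hg.pos y
        have h2 : x / 2 * g y ≤ y * g y := mul_le_mul_of_nonneg_right hy.1 hgy.le
        have h3 : x / 2 * g y ≤ x / 2 * (4 * g x) := by nlinarith [mul_pos hx0 hgx]
        exact le_of_mul_le_mul_left h3 (half_pos hx0)
    rw [intervalIntegral.integral_const, smul_eq_mul] at this
    linarith

/-- Karamata's theorem at index `-1`. -/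
theorem mul_self_isLittleO_primitive (hg : IsRegVarNegOne g) :
    (fun x => x * g x) =o[atTop] fun x => ∫ t in (0 : ℝ)..x, g t := by
  have hN : ∀ n : ℕ, ∀ᶠ x in atTop, n / 8 * (x * g x) ≤ ∫ t in (0 : ℝ)..x, g t := by
    intro n
    induction n with
    | zero =>
      filter_upwards [hg.tendsto_primitive.eventually_ge_atTop 0] with x hx
      simpa using hx
    | succ n ih =>
      have hδ : (0 : ℝ) < 1 / (n + 1) := by positivity
      filter_upwards [(tendsto_id.atTop_div_const (two_pos (α := ℝ))).eventually ih,
        hg.eventually_dyadic_bounds, hg.eventually_slowly_varying hδ,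
        eventually_gt_atTop 0] with x h1 h2 h3 hx0
      have h4 := (h3 (x / 2) ⟨le_rfl, by linarith⟩).1
      simp only [id] at h1
      have h5 := mul_le_mul_of_nonneg_left h4 (show (0 : ℝ) ≤ n / 8 by positivity)
      have h6 : (n : ℝ) / 8 * ((1 - 1 / (n + 1)) * (x * g x)) =
          n / 8 * (x * g x) - (n / (n + 1)) / 8 * (x * g x) := by ring
      have h7 : (n : ℝ) / (n + 1) ≤ 1 := by
        rw [div_le_one (by positivity)]; linarith
      have hL := mul_pos hx0 (hg.pos x)
      push_cast
      nlinarith [h2.1, mul_le_mul_of_nonneg_right h7 hL.le]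
  rw [isLittleO_iff]
  intro c hc
  obtain ⟨n, hn⟩ := exists_nat_gt (8 / c)
  filter_upwards [hN n, eventually_gt_atTop 0] with x hx hx0
  have hL := mul_pos hx0 (hg.pos x)
  have hn8 : 1 / c < n / 8 := by
    rw [div_lt_div_iff₀ hc (by norm_num)]
    rw [div_lt_iff₀ hc] at hn
    linarith
  have h1 : 1 / c * (x * g x) ≤ ∫ t in (0 : ℝ)..x, g t :=
    (mul_le_mul_of_nonneg_right hn8.le hL.le).trans hx
  have h2 : 0 ≤ ∫ t in (0 : ℝ)..x, g t := le_trans (by positivity) h1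
  rw [Real.norm_of_nonneg hL.le, Real.norm_of_nonneg h2]
  calc x * g x = c * (1 / c * (x * g x)) := by field_simp
    _ ≤ _ := mul_le_mul_of_nonneg_left h1 hc.le

theorem eventually_primitive_pos (hg : IsRegVarNegOne g) :
    ∀ᶠ x in atTop, 0 < ∫ t in (0 : ℝ)..x, g t :=
  hg.tendsto_primitive.eventually_gt_atTop 0

theorem tendsto_mul_self_div_primitive (hg : IsRegVarNegOne g) :
    Tendsto (fun x => x * g x / ∫ t in (0 : ℝ)..x, g t) atTop (𝓝 0) :=
  hg.mul_self_isLittleO_primitive.tendsto_div_nhds_zero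

theorem tendsto_primitive_half_div (hg : IsRegVarNegOne g) :
    Tendsto (fun x => (∫ t in (0 : ℝ)..x / 2, g t) / ∫ t in (0 : ℝ)..x, g t) atTop (𝓝 1) := by
  have h1 : Tendsto (fun x => 1 - 2 * (x * g x / ∫ t in (0 : ℝ)..x, g t)) atTop (𝓝 1) := by
    simpa using (hg.tendsto_mul_self_div_primitive.const_mul 2).const_sub 1
  refine tendsto_of_tendsto_of_tendsto_of_le_of_le' h1 tendsto_const_nhds ?_ ?_
  · filter_upwards [hg.eventually_primitive_pos, hg.eventually_dyadic_bounds] with x hx h2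
    rw [le_div_iff₀ hx, sub_mul, one_mul, mul_assoc, div_mul_cancel₀ _ hx.ne']
    linarith [h2.2]
  · filter_upwards [hg.eventually_primitive_pos, eventually_gt_atTop 0] with x hx hx0
    rw [div_le_one hx]
    exact hg.primitive_mono (by linarith)

theorem tendsto_primitive_mul_self_div (hg : IsRegVarNegOne g) :
    Tendsto (fun x => (∫ t in (0 : ℝ)..x, t * g t) / (x * ∫ t in (0 : ℝ)..x, g t))
      atTop (𝓝 0) := by
  have hGc : Continuous fun x => ∫ t in (0 : ℝ)..x, g t :=
    continuous_primitive hg.intervalIntegrable 0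
  have hG0 : ∀ x, 0 ≤ x → 0 ≤ ∫ t in (0 : ℝ)..x, g t := fun x hx =>
    integral_nonneg hx fun t _ => (hg.pos t).le
  have hdiv : Tendsto (fun x => ∫ s in (0 : ℝ)..x, ∫ t in (0 : ℝ)..s, g t) atTop atTop := by
    obtain ⟨X, hX⟩ := eventually_atTop.1
      ((hg.tendsto_primitive.eventually_ge_atTop 1).and (eventually_ge_atTop 0))
    have hX0 := (hX X le_rfl).2
    refine tendsto_atTop_mono' _ ?_ (tendsto_atTop_add_const_right atTop (-X) tendsto_id)
    filter_upwards [eventually_ge_atTop X] with x hx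
    have h1 : ∫ s in X..x, ∫ t in (0 : ℝ)..s, g t ≤ ∫ s in (0 : ℝ)..x, ∫ t in (0 : ℝ)..s, g t :=
      integral_mono_interval hX0 hx le_rfl
        ((ae_restrict_mem measurableSet_Ioc).mono fun t ht => hG0 t ht.1.le)
        (hGc.intervalIntegrable _ _)
    have h2 := integral_mono_on hx (intervalIntegrable_const (c := (1 : ℝ)))
      (hGc.intervalIntegrable (μ := volume) X x) fun s hs => (hX s hs.1).1
    rw [intervalIntegral.integral_const, smul_eq_mul, mul_one] at h2
    simp only [id]
    linarith
  have hL : ∀ x, IntervalIntegrable (fun t => t * g t) volume 0 x := fun x =>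
    (hg.intervalIntegrable 0 x).continuousOn_mul continuousOn_id
  have h1 := isLittleO_primitive (fun x _ => hL x) (fun x _ => hGc.intervalIntegrable 0 x) hG0
    hg.mul_self_isLittleO_primitive hdiv
  refine (h1.trans_isBigO (IsBigO.of_bound 1 ?_)).tendsto_div_nhds_zero
  filter_upwards [eventually_ge_atTop 0] with x hx
  rw [Real.norm_of_nonneg (integral_nonneg hx fun s hs => hG0 s hs.1),
    Real.norm_of_nonneg (mul_nonneg hx (hG0 x hx)), one_mul]
  have := integral_mono_on hx (hGc.intervalIntegrable (μ := volume) 0 x)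
    (intervalIntegrable_const (c := ∫ t in (0 : ℝ)..x, g t)) fun s hs => hg.primitive_mono hs.2
  rwa [intervalIntegral.integral_const, smul_eq_mul, sub_zero] at this

end IsRegVarNegOne

theorem antitone_tail (μ : Measure ℝ) [IsFiniteMeasure μ] :
    Antitone fun x => μ.real (Ioi x) :=
  fun _ _ hab => measureReal_mono (Ioi_subset_Ioi hab)

/-- Integration by parts against the tail of a finite measure. -/
theorem setIntegral_Ioc_add_mul_tail (μ : Measure ℝ) [IsFiniteMeasure μ] {Φ φ : ℝ → ℝ}
    (hφ : Continuous φ) (hφ0 : ∀ t, 0 ≤ t → 0 ≤ φ t) (hΦ : ∀ t, HasDerivAt Φ (φ t) t)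
    (h0 : Φ 0 = 0) {a : ℝ} (ha : 0 ≤ a) :
    ∫ y in Ioc 0 a, Φ y ∂μ + Φ a * μ.real (Ioi a) = ∫ t in (0 : ℝ)..a, φ t * μ.real (Ioi t) := by
  have hΦc : Continuous Φ := continuous_iff_continuousAt.2 fun t => (hΦ t).continuousAt
  have hΦint : ∀ b, ∫ t in (0 : ℝ)..b, φ t = Φ b := fun b => by
    rw [integral_eq_sub_of_hasDerivAt (fun t _ => hΦ t) (hφ.intervalIntegrable _ _), h0, sub_zero]
  have hnn : ∀ y : ℝ, 0 ≤ min (max y 0) a := fun y => le_min (le_max_right _ _) ha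
  have hΦnn : ∀ b, 0 ≤ b → 0 ≤ Φ b := fun b hb => by
    rw [← hΦint]; exact integral_nonneg hb fun t ht => hφ0 t ht.1
  have hsplit : (fun y => Φ (min (max y 0) a)) =
      fun y => (Ioc 0 a).indicator Φ y + (Ioi a).indicator (fun _ => Φ a) y := by
    ext y
    rcases le_or_gt y 0 with hy | hy
    · rw [indicator_of_notMem (by simp [hy]), indicator_of_notMem (by simp; linarith),
        max_eq_right hy, min_eq_left ha, h0, add_zero]
    · rcases le_or_gt y a with hya | hya
      · rw [indicator_of_mem (show y ∈ Ioc 0 a from ⟨hy, hya⟩), indicator_of_notMem (by simpa using hya),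
          max_eq_left hy.le, min_eq_left hya, add_zero]
      · rw [indicator_of_notMem (by simp [hya]), indicator_of_mem (show y ∈ Ioi a from hya), max_eq_left hy.le,
          min_eq_right hya.le, zero_add]
  have hL : ∫ y, Φ (min (max y 0) a) ∂μ =
      ∫ y in Ioc 0 a, Φ y ∂μ + Φ a * μ.real (Ioi a) := by
    have hi : IntegrableOn Φ (Ioc 0 a) μ :=
      (hΦc.continuousOn.integrableOn_compact isCompact_Icc).mono_set Ioc_subset_Icc_self
    rw [hsplit, integral_add (hi.integrable_indicator measurableSet_Ioc)
      ((integrable_const _).indicator measurableSet_Ioi), MeasureTheory.integral_indicator measurableSet_Ioc,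
      MeasureTheory.integral_indicator measurableSet_Ioi, setIntegral_const, smul_eq_mul, mul_comm (Φ a)]
  have hTm : Measurable fun t => μ.real (Ioi t) := (antitone_tail μ).measurable
  rw [← hL, integral_of_le ha, ← restrict_Ioo_eq_restrict_Ioc,
    integral_eq_lintegral_of_nonneg_ae (Eventually.of_forall fun y => hΦnn _ (hnn y))
      (by fun_prop),
    integral_eq_lintegral_of_nonneg_ae
      ((ae_restrict_mem measurableSet_Ioo).mono fun t ht =>
        mul_nonneg (hφ0 t ht.1.le) measureReal_nonneg)
      (hφ.measurable.mul hTm).aestronglyMeasurable]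
  congr 1
  have hcake := lintegral_comp_eq_lintegral_meas_lt_mul μ (f := fun y => min (max y 0) a) (g := φ)
    (Eventually.of_forall hnn) (by fun_prop) (fun t _ => hφ.intervalIntegrable _ _)
    ((ae_restrict_mem measurableSet_Ioi).mono fun t ht => hφ0 t (le_of_lt ht))
  simp only [hΦint] at hcake
  rw [hcake, ← lintegral_indicator measurableSet_Ioi, ← lintegral_indicator measurableSet_Ioo]
  refine lintegral_congr fun t => ?_
  by_cases ht : 0 < t
  · rw [indicator_of_mem (show t ∈ Ioi (0 : ℝ) from ht)]
    by_cases hta : t < a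
    · rw [indicator_of_mem (show t ∈ Ioo 0 a from ⟨ht, hta⟩), ENNReal.ofReal_mul (hφ0 t ht.le),
        ofReal_measureReal, mul_comm]
      congr 2
      ext y
      simp [hta, not_lt.2 ht.le]
    · rw [indicator_of_notMem (by simp [hta])]
      simp [hta]
  · rw [indicator_of_notMem (by simpa using ht), indicator_of_notMem (by simp [ht])]

/-- The exponentially tilted tail `e^{αx} μ(x, ∞)`. -/
noncomputable def tilt (α : ℝ) (μ : Measure ℝ) (x : ℝ) : ℝ := Real.exp (α * x) * μ.real (Ioi x)

theorem setIntegral_exp (μ : Measure ℝ) [IsProbabilityMeasure μ] {α : ℝ} (hα : 0 < α) {a : ℝ}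
    (ha : 0 ≤ a) : ∫ y in Ioc 0 a, Real.exp (α * y) ∂μ =
      α * (∫ t in (0 : ℝ)..a, tilt α μ t) - tilt α μ a + μ.real (Ioi 0) := by
  have hexp : ∀ t, HasDerivAt (fun t => Real.exp (α * t) - 1) (α * Real.exp (α * t)) t := fun t => by
    simpa [mul_comm] using (((hasDerivAt_id t).const_mul α).exp).sub_const 1
  have h := setIntegral_Ioc_add_mul_tail μ (Φ := fun t => Real.exp (α * t) - 1)
    (φ := fun t => α * Real.exp (α * t)) (by fun_prop) (fun t _ => by positivity) hexp (by simp) ha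
  have hint : IntegrableOn (fun y => Real.exp (α * y)) (Ioc 0 a) μ :=
    (Continuous.continuousOn (by fun_prop)).integrableOn_compact isCompact_Icc |>.mono_set
      Ioc_subset_Icc_self
  rw [integral_sub hint (integrable_const _), setIntegral_const, smul_eq_mul, mul_one] at h
  have hunion : μ.real (Ioi 0) = μ.real (Ioc 0 a) + μ.real (Ioi a) := by
    rw [← Ioc_union_Ioi_eq_Ioi ha, measureReal_union _ measurableSet_Ioi]
    exact Ioc_disjoint_Ioi le_rfl
  simp only [mul_assoc, intervalIntegral.integral_const_mul] at h
  simp only [tilt]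
  linarith

theorem setIntegral_mul_exp_le (μ : Measure ℝ) [IsProbabilityMeasure μ] {α : ℝ} (hα : 0 < α)
    (hi : ∀ a b, IntervalIntegrable (tilt α μ) volume a b) {a : ℝ} (ha : 0 ≤ a) :
    ∫ y in Ioc 0 a, y * Real.exp (α * y) ∂μ ≤
      (∫ t in (0 : ℝ)..a, tilt α μ t) + α * ∫ t in (0 : ℝ)..a, t * tilt α μ t := by
  have hexp : ∀ t, HasDerivAt (fun t => t * Real.exp (α * t)) ((1 + α * t) * Real.exp (α * t)) t :=
    fun t => by
      refine ((hasDerivAt_id t).mul (((hasDerivAt_id t).const_mul α).exp)).congr_deriv ?_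
      simp only [id]
      ring
  have h := setIntegral_Ioc_add_mul_tail μ (Φ := fun t => t * Real.exp (α * t))
    (φ := fun t => (1 + α * t) * Real.exp (α * t)) (by fun_prop) (fun t _ => by positivity) hexp
    (by simp) ha
  have hsum : ∫ t in (0 : ℝ)..a, (1 + α * t) * Real.exp (α * t) * μ.real (Ioi t) =
      (∫ t in (0 : ℝ)..a, tilt α μ t) + α * ∫ t in (0 : ℝ)..a, t * tilt α μ t := by
    have hit : IntervalIntegrable (fun t => t * tilt α μ t) volume 0 a :=
      (hi 0 a).continuousOn_mul continuousOn_id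
    rw [← intervalIntegral.integral_const_mul, ← integral_add (hi 0 a) (hit.const_mul α)]
    refine integral_congr fun t _ => ?_
    simp only [tilt]
    ring
  rw [hsum] at h
  have : 0 ≤ a * Real.exp (α * a) * μ.real (Ioi a) := by positivity
  linarith

theorem intervalIntegrable_tilt (α : ℝ) (μ : Measure ℝ) [IsFiniteMeasure μ] (a b : ℝ) :
    IntervalIntegrable (tilt α μ) volume a b :=
  ((antitone_tail μ).intervalIntegrable).continuousOn_mul
    (Continuous.continuousOn (by fun_prop))

theorem measurable_tilt (α : ℝ) (μ : Measure ℝ) [IsFiniteMeasure μ] : Measurable (tilt α μ) :=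
  Measurable.mul (by fun_prop) (antitone_tail μ).measurable

theorem tendsto_setIntegral_exp_div {μ : Measure ℝ} [IsProbabilityMeasure μ] {α : ℝ} (hα : 0 < α)
    (hg : IsRegVarNegOne (tilt α μ)) :
    Tendsto (fun x => (∫ y in Ioc 0 (x / 2), Real.exp (α * y) ∂μ) /
      ∫ t in (0 : ℝ)..x, tilt α μ t) atTop (𝓝 α) := by
  have hhalf : Tendsto (fun x : ℝ => x / 2) atTop atTop := tendsto_id.atTop_div_const two_pos
  have hdiv : Tendsto (fun x => tilt α μ x / ∫ t in (0 : ℝ)..x, tilt α μ t) atTop (𝓝 0) := by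
    have := hg.tendsto_mul_self_div_primitive.mul tendsto_inv_atTop_zero
    rw [mul_zero] at this
    refine this.congr' ?_
    filter_upwards [eventually_gt_atTop 0] with x hx
    field_simp
  have h := ((hg.tendsto_primitive_half_div.const_mul α).sub
    ((hdiv.comp hhalf).mul hg.tendsto_primitive_half_div)).add
    (hg.tendsto_primitive.inv_tendsto_atTop.const_mul (μ.real (Ioi 0)))
  simp only [mul_one, mul_zero, sub_zero, add_zero] at h
  refine h.congr' ?_
  filter_upwards [eventually_gt_atTop 0, hhalf.eventually hg.eventually_primitive_pos,
    hg.eventually_primitive_pos] with x hx h1 h2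
  rw [setIntegral_exp μ hα (half_pos hx).le]
  simp only [Function.comp, Pi.inv_apply]
  field_simp

theorem tendsto_setIntegral_mul_exp_div {μ : Measure ℝ} [IsProbabilityMeasure μ] {α : ℝ}
    (hα : 0 < α) (hg : IsRegVarNegOne (tilt α μ)) :
    Tendsto (fun x => (∫ y in Ioc 0 (x / 2), y * Real.exp (α * y) ∂μ) /
      (x * ∫ t in (0 : ℝ)..x, tilt α μ t)) atTop (𝓝 0) := by
  have hhalf : Tendsto (fun x : ℝ => x / 2) atTop atTop := tendsto_id.atTop_div_const two_pos
  have h := (tendsto_inv_atTop_zero.add (hg.tendsto_primitive_mul_self_div.const_mul α)).comp hhalf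
  rw [mul_zero, add_zero] at h
  refine squeeze_zero' ?_ ?_ h
  · filter_upwards [eventually_gt_atTop 0, hg.eventually_primitive_pos] with x hx h2
    refine div_nonneg (setIntegral_nonneg measurableSet_Ioc fun y hy => ?_) (by positivity)
    exact mul_nonneg hy.1.le (Real.exp_pos _).le
  · filter_upwards [eventually_gt_atTop 0, hhalf.eventually hg.eventually_primitive_pos,
      hg.eventually_primitive_pos] with x hx h1 h2
    have hx2 := half_pos hx
    have hle := setIntegral_mul_exp_le μ hα hg.intervalIntegrable hx2.le
    have hM : 0 ≤ ∫ y in Ioc 0 (x / 2), y * Real.exp (α * y) ∂μ :=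
      setIntegral_nonneg measurableSet_Ioc fun y hy => mul_nonneg hy.1.le (Real.exp_pos _).le
    have hmono := hg.primitive_mono (show x / 2 ≤ x by linarith)
    dsimp only at hmono
    calc _ ≤ (∫ y in Ioc 0 (x / 2), y * Real.exp (α * y) ∂μ) /
          (x / 2 * ∫ t in (0 : ℝ)..x / 2, tilt α μ t) := by
          gcongr
          linarith
      _ ≤ _ := by
          rw [div_le_iff₀ (by positivity)]
          refine hle.trans_eq ?_
          simp only [Function.comp]
          field_simp

/-- The contribution of a moderate first summand to the tail of a convolution. -/
theorem tendsto_setIntegral_tail_sub_div {μ ν : Measure ℝ} [IsProbabilityMeasure μ]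
    [IsProbabilityMeasure ν] {α : ℝ} (hα : 0 < α) (hg : IsRegVarNegOne (tilt α μ))
    (hh : IsRegVarNegOne (tilt α ν)) :
    Tendsto (fun x => Real.exp (α * x) * (∫ y in Iic (x / 2), ν.real (Ioi (x - y)) ∂μ) /
      (tilt α ν x * ∫ t in (0 : ℝ)..x, tilt α μ t)) atTop (𝓝 α) := by
  have hJ := tendsto_setIntegral_exp_div hα hg
  have hM := tendsto_setIntegral_mul_exp_div hα hg
  have hbounds : ∀ ε : ℝ, 0 < ε → ∀ᶠ x in atTop,
      (1 - ε) * ((∫ y in Ioc 0 (x / 2), Real.exp (α * y) ∂μ) / ∫ t in (0 : ℝ)..x, tilt α μ t) ≤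
        Real.exp (α * x) * (∫ y in Iic (x / 2), ν.real (Ioi (x - y)) ∂μ) /
          (tilt α ν x * ∫ t in (0 : ℝ)..x, tilt α μ t) ∧
      Real.exp (α * x) * (∫ y in Iic (x / 2), ν.real (Ioi (x - y)) ∂μ) /
          (tilt α ν x * ∫ t in (0 : ℝ)..x, tilt α μ t) ≤
        (1 + ε) * ((∫ y in Ioc 0 (x / 2), Real.exp (α * y) ∂μ) / (∫ t in (0 : ℝ)..x, tilt α μ t) +
          2 * ((∫ y in Ioc 0 (x / 2), y * Real.exp (α * y) ∂μ) /
            (x * ∫ t in (0 : ℝ)..x, tilt α μ t))) + (∫ t in (0 : ℝ)..x, tilt α μ t)⁻¹ := by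
    intro ε hε
    filter_upwards [eventually_gt_atTop 0, hg.eventually_primitive_pos,
      hh.eventually_slowly_varying hε] with x hx hG hsv
    have hx2 := half_pos hx
    have hgx := hh.pos x
    have hanti := antitone_tail ν
    have hTm : Measurable fun y => ν.real (Ioi (x - y)) := hanti.measurable.comp (by fun_prop)
    have hTi : Integrable (fun y => ν.real (Ioi (x - y))) μ :=
      (integrable_const (1 : ℝ)).mono' hTm.aestronglyMeasurable
        (Eventually.of_forall fun y => by
          rw [Real.norm_of_nonneg measureReal_nonneg]; exact measureReal_le_one)
    have hei : IntegrableOn (fun y => Real.exp (α * y)) (Ioc 0 (x / 2)) μ :=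
      (Continuous.continuousOn (by fun_prop)).integrableOn_compact isCompact_Icc |>.mono_set
        Ioc_subset_Icc_self
    have hyei : IntegrableOn (fun y => y * Real.exp (α * y)) (Ioc 0 (x / 2)) μ :=
      (Continuous.continuousOn (by fun_prop)).integrableOn_compact isCompact_Icc |>.mono_set
        Ioc_subset_Icc_self
    have hsplit : ∫ y in Iic (x / 2), ν.real (Ioi (x - y)) ∂μ =
        ∫ y in Iic 0, ν.real (Ioi (x - y)) ∂μ + ∫ y in Ioc 0 (x / 2), ν.real (Ioi (x - y)) ∂μ := by
      rw [← Iic_union_Ioc_eq_Iic hx2.le]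
      exact setIntegral_union (Iic_disjoint_Ioc le_rfl) measurableSet_Ioc hTi.integrableOn
        hTi.integrableOn
    have hneg0 : 0 ≤ ∫ y in Iic 0, ν.real (Ioi (x - y)) ∂μ :=
      setIntegral_nonneg measurableSet_Iic fun _ _ => measureReal_nonneg
    have hneg1 : ∫ y in Iic 0, ν.real (Ioi (x - y)) ∂μ ≤ ν.real (Ioi x) := by
      calc _ ≤ ∫ _ in Iic (0 : ℝ), ν.real (Ioi x) ∂μ :=
            setIntegral_mono_on hTi.integrableOn (integrable_const _).integrableOn
              measurableSet_Iic fun y hy => hanti (by linarith [show y ≤ 0 from hy])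
        _ ≤ _ := by
            rw [setIntegral_const, smul_eq_mul]
            exact mul_le_of_le_one_left measureReal_nonneg measureReal_le_one
    have hpt : ∀ y, Real.exp (α * x) * ν.real (Ioi (x - y)) =
        Real.exp (α * y) * tilt α ν (x - y) := fun y => by
      rw [tilt, ← mul_assoc, ← Real.exp_add]; ring_nf
    have hmid : Real.exp (α * x) * ∫ y in Ioc 0 (x / 2), ν.real (Ioi (x - y)) ∂μ =
        ∫ y in Ioc 0 (x / 2), Real.exp (α * x) * ν.real (Ioi (x - y)) ∂μ :=
      (MeasureTheory.integral_const_mul _ _).symm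
    have hlow : (1 - ε) * tilt α ν x * ∫ y in Ioc 0 (x / 2), Real.exp (α * y) ∂μ ≤
        Real.exp (α * x) * ∫ y in Ioc 0 (x / 2), ν.real (Ioi (x - y)) ∂μ := by
      rw [hmid, ← MeasureTheory.integral_const_mul]
      refine setIntegral_mono_on (hei.const_mul _) (hTi.integrableOn.const_mul _)
        measurableSet_Ioc fun y hy => ?_
      rw [hpt, mul_comm]
      refine mul_le_mul_of_nonneg_left ?_ (Real.exp_pos _).le
      have h1 := (hsv (x - y) ⟨by linarith [hy.2], by linarith [hy.1]⟩).1
      have h2 := mul_pos hy.1 (hh.pos (x - y))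
      refine le_of_mul_le_mul_left ?_ hx
      linarith
    have hupp : Real.exp (α * x) * ∫ y in Ioc 0 (x / 2), ν.real (Ioi (x - y)) ∂μ ≤
        (1 + ε) * tilt α ν x * (∫ y in Ioc 0 (x / 2), Real.exp (α * y) ∂μ +
          2 / x * ∫ y in Ioc 0 (x / 2), y * Real.exp (α * y) ∂μ) := by
      rw [hmid, ← MeasureTheory.integral_const_mul, ← integral_add hei (hyei.const_mul _),
        ← MeasureTheory.integral_const_mul]
      refine setIntegral_mono_on (hTi.integrableOn.const_mul _)
        ((hei.add (hyei.const_mul _)).const_mul _) measurableSet_Ioc fun y hy => ?_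
      rw [hpt]
      have h1 := (hsv (x - y) ⟨by linarith [hy.2], by linarith [hy.1]⟩).2
      have hxy : 0 < x - y := by linarith [hy.2]
      have h3 : tilt α ν (x - y) ≤ (1 + ε) * tilt α ν x * (1 + 2 / x * y) := by
        refine le_of_mul_le_mul_left (h1.trans ?_) hxy
        have h4 : x ≤ (x - y) * (1 + 2 / x * y) := by
          have h5 : (x - y) * (1 + 2 / x * y) = x + y * (x - 2 * y) / x := by
            field_simp; ring
          rw [h5]
          have : 0 ≤ x - 2 * y := by linarith [hy.2]
          have := hy.1
          linarith [show 0 ≤ y * (x - 2 * y) / x by positivity]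
        have := mul_le_mul_of_nonneg_left h4 (show 0 ≤ (1 + ε) * tilt α ν x by positivity)
        linarith
      have := mul_le_mul_of_nonneg_left h3 (Real.exp_pos (α * y)).le
      refine this.trans_eq ?_
      ring
    have htx : Real.exp (α * x) * ν.real (Ioi x) = tilt α ν x := rfl
    have hex := Real.exp_pos (α * x)
    rw [hsplit, mul_add]
    constructor
    · rw [le_div_iff₀ (by positivity)]
      have : (1 - ε) * ((∫ y in Ioc 0 (x / 2), Real.exp (α * y) ∂μ) /
          ∫ t in (0 : ℝ)..x, tilt α μ t) * (tilt α ν x * ∫ t in (0 : ℝ)..x, tilt α μ t) =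
          (1 - ε) * tilt α ν x * ∫ y in Ioc 0 (x / 2), Real.exp (α * y) ∂μ := by
        field_simp
      rw [this]
      linarith [mul_nonneg hex.le hneg0]
    · rw [div_le_iff₀ (by positivity)]
      have h1 := mul_le_mul_of_nonneg_left hneg1 hex.le
      rw [htx] at h1
      refine (add_le_add h1 hupp).trans_eq ?_
      field_simp
      ring
  have hupper : Tendsto (fun x => (∫ y in Ioc 0 (x / 2), Real.exp (α * y) ∂μ) /
      (∫ t in (0 : ℝ)..x, tilt α μ t) + 2 * ((∫ y in Ioc 0 (x / 2), y * Real.exp (α * y) ∂μ) /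
        (x * ∫ t in (0 : ℝ)..x, tilt α μ t))) atTop (𝓝 α) := by
    simpa using hJ.add (hM.const_mul 2)
  have hinv : Tendsto (fun x => (∫ t in (0 : ℝ)..x, tilt α μ t)⁻¹) atTop (𝓝 0) :=
    hg.tendsto_primitive.inv_tendsto_atTop
  refine tendsto_order.2 ⟨fun a ha => ?_, fun b hb => ?_⟩
  · have hε : 0 < (α - a) / (2 * α) := div_pos (sub_pos.2 ha) (by positivity)
    have hlt : a < (1 - (α - a) / (2 * α)) * α := by
      have : (1 - (α - a) / (2 * α)) * α = (α + a) / 2 := by field_simp; ring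
      rw [this]; linarith
    filter_upwards [hbounds _ hε, (hJ.const_mul _).eventually_const_lt hlt] with x h1 h2
    exact h2.trans_le h1.1
  · have hε : 0 < (b - α) / (2 * α) := div_pos (sub_pos.2 hb) (by positivity)
    have hlt : (1 + (b - α) / (2 * α)) * α + 0 < b := by
      have : (1 + (b - α) / (2 * α)) * α = (b + α) / 2 := by field_simp; ring
      rw [this]; linarith
    filter_upwards [hbounds _ hε, ((hupper.const_mul _).add hinv).eventually_lt_const hlt]
      with x h1 h2
    exact h1.2.trans_lt h2

theorem measureReal_prod_lt_add (μ ν : Measure ℝ) [IsProbabilityMeasure μ]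
    [IsProbabilityMeasure ν] (x : ℝ) :
    (μ.prod ν).real {p : ℝ × ℝ | x < p.1 + p.2} =
      ∫ y in Iic (x / 2), ν.real (Ioi (x - y)) ∂μ + ∫ y in Iic (x / 2), μ.real (Ioi (x - y)) ∂ν +
        μ.real (Ioi (x / 2)) * ν.real (Ioi (x / 2)) := by
  have hS : MeasurableSet {p : ℝ × ℝ | x < p.1 + p.2} :=
    measurableSet_lt measurable_const (measurable_fst.add measurable_snd)
  have hA : MeasurableSet {p : ℝ × ℝ | x < p.1 + p.2 ∧ p.1 ≤ x / 2} :=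
    hS.inter (measurableSet_le measurable_fst measurable_const)
  have hB : MeasurableSet {p : ℝ × ℝ | x < p.1 + p.2 ∧ p.2 ≤ x / 2} :=
    hS.inter (measurableSet_le measurable_snd measurable_const)
  have hC : MeasurableSet (Ioi (x / 2) ×ˢ Ioi (x / 2)) := measurableSet_Ioi.prod measurableSet_Ioi
  have hunion : {p : ℝ × ℝ | x < p.1 + p.2} =
      ({p : ℝ × ℝ | x < p.1 + p.2 ∧ p.1 ≤ x / 2} ∪ {p : ℝ × ℝ | x < p.1 + p.2 ∧ p.2 ≤ x / 2}) ∪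
        Ioi (x / 2) ×ˢ Ioi (x / 2) := by
    ext p
    simp only [mem_union, mem_ofPred_eq, mem_prod, mem_Ioi]
    constructor
    · intro h
      rcases le_or_gt p.1 (x / 2) with h1 | h1
      · exact Or.inl (Or.inl ⟨h, h1⟩)
      · rcases le_or_gt p.2 (x / 2) with h2 | h2
        · exact Or.inl (Or.inr ⟨h, h2⟩)
        · exact Or.inr ⟨h1, h2⟩
    · rintro ((h | h) | h)
      · exact h.1
      · exact h.1
      · linarith [h.1, h.2]
  have hreal : ∀ (ρ σ : Measure ℝ) [IsProbabilityMeasure ρ] [IsProbabilityMeasure σ],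
      (∫⁻ y in Iic (x / 2), σ (Ioi (x - y)) ∂ρ).toReal =
        ∫ y in Iic (x / 2), σ.real (Ioi (x - y)) ∂ρ := by
    intro ρ σ _ _
    have hm : Antitone fun z => σ (Ioi z) := fun _ _ h => measure_mono (Ioi_subset_Ioi h)
    exact (integral_toReal
      (hm.measurable.comp (measurable_const.sub measurable_id)).aemeasurable
      (Eventually.of_forall fun y => measure_lt_top _ _)).symm
  rw [hunion, measureReal_union _ hC, measureReal_union _ hB, measureReal_prod_prod]
  · congr 2
    · rw [measureReal_def, Measure.prod_apply hA, ← hreal, ← lintegral_indicator measurableSet_Iic]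
      congr 1
      refine lintegral_congr fun y => ?_
      by_cases hy : y ≤ x / 2
      · rw [indicator_of_mem (show y ∈ Iic (x / 2) from hy)]
        congr 1
        ext z
        simp [hy, sub_lt_iff_lt_add']
      · simp [hy]
    · rw [measureReal_def, Measure.prod_apply_symm hB, ← hreal,
        ← lintegral_indicator measurableSet_Iic]
      congr 1
      refine lintegral_congr fun y => ?_
      by_cases hy : y ≤ x / 2
      · rw [indicator_of_mem (show y ∈ Iic (x / 2) from hy)]
        congr 1
        ext z
        simp [hy, sub_lt_iff_lt_add]
      · simp [hy]
  · rw [Set.disjoint_left]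
    rintro p ⟨h1, h2⟩ ⟨_, h3⟩
    linarith
  · rw [Set.disjoint_left]
    rintro p (⟨_, h2⟩ | ⟨_, h2⟩) ⟨h3, h4⟩
    · exact absurd h2 (not_le.2 h3)
    · exact absurd h2 (not_le.2 h4)

theorem tilt_isEquivalent {μ : Measure ℝ} {α : ℝ} {f : ℝ → ℝ}
    (h : (fun x => μ.real (Ioi x)) ~[atTop] fun x => Real.exp (-α * x) * f x) :
    tilt α μ ~[atTop] f := by
  have h1 := (IsEquivalent.refl (u := fun x => Real.exp (α * x)) (l := atTop)).mul h
  refine h1.congr_right (Eventually.of_forall fun x => ?_)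
  simp only [Pi.mul_apply]
  rw [← mul_assoc, ← Real.exp_add, show α * x + -α * x = 0 by ring, Real.exp_zero, one_mul]

theorem isEquivalent_primitive_tilt {μ : Measure ℝ} [IsProbabilityMeasure μ] {α : ℝ} {f : ℝ → ℝ}
    (hf0 : ∀ x, 0 ≤ f x) (hdiv : Tendsto (fun x => ∫ y in (0 : ℝ)..x, f y) atTop atTop)
    (h : tilt α μ ~[atTop] f) :
    (fun x => ∫ t in (0 : ℝ)..x, tilt α μ t) ~[atTop] fun x => ∫ t in (0 : ℝ)..x, f t := by
  refine isEquivalent_primitive (fun x _ => intervalIntegrable_tilt α μ 0 x) (fun x hx => ?_)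
    (fun x _ => hf0 x) h hdiv
  obtain ⟨X, hX, hxX⟩ := ((hdiv.eventually_gt_atTop 0).and (eventually_ge_atTop x)).exists
  have hi : IntervalIntegrable f volume 0 X := by
    by_contra hc
    exact hX.ne' (integral_undef hc)
  refine hi.mono_set ?_
  rw [uIcc_of_le hx, uIcc_of_le (hx.trans hxX)]
  exact Icc_subset_Icc_right hxX

theorem isRegVarNegOne_tilt {μ : Measure ℝ} [IsProbabilityMeasure μ] {α : ℝ} {f : ℝ → ℝ}
    (hf0 : ∀ x, 0 ≤ f x) (hev : ∀ᶠ x in atTop, 0 < f x)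
    (hrv : ∀ t : ℝ, 0 < t → Tendsto (fun x => f (x * t) / f x) atTop (𝓝 (t ^ (-1 : ℝ))))
    (hdiv : Tendsto (fun x => ∫ y in (0 : ℝ)..x, f y) atTop atTop)
    (h : tilt α μ ~[atTop] f) : IsRegVarNegOne (tilt α μ) where
  measurable := measurable_tilt α μ
  pos x := by
    obtain ⟨y, hy, hxy⟩ := ((h.eventually_pos hev).and (eventually_ge_atTop x)).exists
    have hT : 0 < μ.real (Ioi y) := pos_of_mul_pos_right hy (Real.exp_pos _).le
    exact mul_pos (Real.exp_pos _) (hT.trans_le (antitone_tail μ hxy))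
  intervalIntegrable := intervalIntegrable_tilt α μ
  tendsto_div t ht := by
    rw [← Real.rpow_neg_one]
    have h1 := (h.comp_tendsto (tendsto_id.atTop_mul_const ht)).div h
    exact h1.symm.tendsto_nhds (hrv t ht)
  tendsto_primitive := (isEquivalent_primitive_tilt hf0 hdiv h).symm.tendsto_atTop hdiv

theorem tilt_half_mul_isLittleO {μ ν : Measure ℝ} {α : ℝ} (hg : IsRegVarNegOne (tilt α μ))
    (hh : IsRegVarNegOne (tilt α ν)) :
    (fun x => tilt α μ (x / 2) * tilt α ν (x / 2)) =o[atTop]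
      fun x => tilt α μ x * ∫ t in (0 : ℝ)..x, tilt α ν t := by
  have h2 : (0 : ℝ) < 2⁻¹ := by norm_num
  have hlim := ((hg.tendsto_div _ h2).mul (hh.tendsto_div _ h2)).mul
    (hh.tendsto_mul_self_div_primitive.mul tendsto_inv_atTop_zero)
  simp only [mul_zero] at hlim
  rw [isLittleO_iff_tendsto' (by
    filter_upwards [hh.eventually_primitive_pos] with x hx h0
    exact absurd h0 (mul_pos (hg.pos x) hx).ne')]
  refine hlim.congr' ?_
  filter_upwards [eventually_gt_atTop 0, hh.eventually_primitive_pos] with x hx hx2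
  have h3 := hg.pos x
  have h4 := hh.pos x
  simp only [← div_eq_mul_inv]
  field_simp

theorem isEquivalent_add {ι : Type*} {l : Filter ι} {u v t w : ι → ℝ} (hv : ∀ᶠ x in l, 0 ≤ v x)
    (hw : ∀ᶠ x in l, 0 ≤ w x) (huv : u ~[l] v) (htw : t ~[l] w) :
    (fun x => u x + t x) ~[l] fun x => v x + w x := by
  have hv' : v =O[l] fun x => v x + w x := IsBigO.of_bound 1 <| by
    filter_upwards [hv, hw] with x h1 h2
    rw [Real.norm_of_nonneg h1, Real.norm_of_nonneg (add_nonneg h1 h2)]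
    linarith
  have hw' : w =O[l] fun x => v x + w x := IsBigO.of_bound 1 <| by
    filter_upwards [hv, hw] with x h1 h2
    rw [Real.norm_of_nonneg h2, Real.norm_of_nonneg (add_nonneg h1 h2)]
    linarith
  refine ((huv.isLittleO.trans_isBigO hv').add (htw.isLittleO.trans_isBigO hw')).congr_left
    fun x => ?_
  simp only [Pi.sub_apply]
  ring

/-- The tail asymptotics of a convolution, in terms of tilted tails. -/
theorem isEquivalent_exp_mul_conv_tail {μ ν : Measure ℝ} [IsProbabilityMeasure μ]
    [IsProbabilityMeasure ν] {α : ℝ} (hα : 0 < α) (hg : IsRegVarNegOne (tilt α μ))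
    (hh : IsRegVarNegOne (tilt α ν)) :
    (fun x => Real.exp (α * x) * (μ.prod ν).real {p : ℝ × ℝ | x < p.1 + p.2}) ~[atTop]
      fun x => α * (tilt α μ x * (∫ t in (0 : ℝ)..x, tilt α ν t) +
        tilt α ν x * ∫ t in (0 : ℝ)..x, tilt α μ t) := by
  have hpart : ∀ {ρ σ : Measure ℝ} [IsProbabilityMeasure ρ] [IsProbabilityMeasure σ],
      IsRegVarNegOne (tilt α ρ) → IsRegVarNegOne (tilt α σ) →
      (fun x => Real.exp (α * x) * ∫ y in Iic (x / 2), σ.real (Ioi (x - y)) ∂ρ) ~[atTop]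
        fun x => α * (tilt α σ x * ∫ t in (0 : ℝ)..x, tilt α ρ t) := by
    intro ρ σ _ _ hρ hσ
    refine isEquivalent_of_tendsto_one ?_
    have := (tendsto_setIntegral_tail_sub_div hα hρ hσ).const_mul α⁻¹
    rw [inv_mul_cancel₀ hα.ne'] at this
    refine this.congr fun x => ?_
    simp only [Pi.div_apply]
    rw [inv_mul_eq_div, div_div, mul_comm (tilt α σ x * _) α]
  have hprod : ∀ {ρ σ : Measure ℝ}, IsRegVarNegOne (tilt α ρ) → IsRegVarNegOne (tilt α σ) →
      ∀ᶠ x in atTop, 0 ≤ α * (tilt α σ x * ∫ t in (0 : ℝ)..x, tilt α ρ t) := by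
    intro ρ σ hρ hσ
    filter_upwards [hρ.eventually_primitive_pos] with x hx
    exact (mul_pos hα (mul_pos (hσ.pos x) hx)).le
  have hsum := isEquivalent_add (hprod hh hg) (hprod hg hh) (hpart hh hg) (hpart hg hh)
  have hsmall : (fun x => tilt α μ (x / 2) * tilt α ν (x / 2)) =o[atTop] fun x =>
      α * (tilt α μ x * ∫ t in (0 : ℝ)..x, tilt α ν t) +
        α * (tilt α ν x * ∫ t in (0 : ℝ)..x, tilt α μ t) := by
    refine (tilt_half_mul_isLittleO hg hh).trans_isBigO (IsBigO.of_bound α⁻¹ ?_)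
    filter_upwards [hh.eventually_primitive_pos, hprod hg hh] with x hx h2
    have h1 := mul_pos (hg.pos x) hx
    rw [Real.norm_of_nonneg h1.le, Real.norm_of_nonneg (by positivity), inv_mul_eq_div,
      le_div_iff₀ hα]
    linarith
  refine ((hsum.add_isLittleO hsmall).congr_left (Eventually.of_forall fun x => ?_)).congr_right
    (Eventually.of_forall fun x => (mul_add _ _ _).symm)
  simp only [Pi.add_apply]
  rw [measureReal_prod_lt_add, tilt, tilt,
    show α * x = α * (x / 2) + α * (x / 2) by ring, Real.exp_add]
  ring

end RegVarTail

/-- For independent `Y₁, Y₂` with non-lattice distributions `Vᵢ ∈ 𝓛₁₁(α)` where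
`V̄ᵢ(x) ∼ e^{-αx} fᵢ(x)`, `fᵢ ∈ 𝓡_{-1}`, `∫₀^∞ fᵢ = ∞`:
`P(Y₁+Y₂ > x) ∼ α e^{-αx} (f₁(x) f₂^I(x) + f₂(x) f₁^I(x))`. -/
theorem conv_tail_index_neg_one (μ₁ μ₂ : Measure ℝ)
    [IsProbabilityMeasure μ₁] [IsProbabilityMeasure μ₂]
    (α : ℝ) (hα : 0 < α) (f₁ f₂ : ℝ → ℝ)
    (hnl1 : ¬ IsLatticeMeasure μ₁) (hnl2 : ¬ IsLatticeMeasure μ₂)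
    (hfnn₁ : ∀ x, 0 ≤ f₁ x) (hfnn₂ : ∀ x, 0 ≤ f₂ x)
    (hlb₁ : ∀ r : ℝ, ∃ C : ℝ, ∀ x ∈ Set.Icc (0:ℝ) r, f₁ x ≤ C)
    (hlb₂ : ∀ r : ℝ, ∃ C : ℝ, ∀ x ∈ Set.Icc (0:ℝ) r, f₂ x ≤ C)
    (hev₁ : ∀ᶠ x in atTop, 0 < f₁ x) (hev₂ : ∀ᶠ x in atTop, 0 < f₂ x)
    (hrv₁ : ∀ t : ℝ, 0 < t →
      Tendsto (fun x => f₁ (x * t) / f₁ x) atTop (nhds (t ^ (-1 : ℝ))))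
    (hrv₂ : ∀ t : ℝ, 0 < t →
      Tendsto (fun x => f₂ (x * t) / f₂ x) atTop (nhds (t ^ (-1 : ℝ))))
    (hdiv₁ : Tendsto (fun x => ∫ y in (0:ℝ)..x, f₁ y) atTop atTop)
    (hdiv₂ : Tendsto (fun x => ∫ y in (0:ℝ)..x, f₂ y) atTop atTop)
    (htail₁ : (fun x => (μ₁ (Set.Ioi x)).toReal) ~[atTop]
      (fun x => Real.exp (-α * x) * f₁ x))
    (htail₂ : (fun x => (μ₂ (Set.Ioi x)).toReal) ~[atTop]
      (fun x => Real.exp (-α * x) * f₂ x)) :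
    (fun x => ((μ₁.prod μ₂) {p : ℝ × ℝ | x < p.1 + p.2}).toReal) ~[atTop]
      (fun x => α * Real.exp (-α * x) *
        (f₁ x * (∫ y in (0:ℝ)..x, f₂ y) + f₂ x * (∫ y in (0:ℝ)..x, f₁ y))) := by
  have e₁ := RegVarTail.tilt_isEquivalent htail₁
  have e₂ := RegVarTail.tilt_isEquivalent htail₂
  have i₁ := RegVarTail.isEquivalent_primitive_tilt hfnn₁ hdiv₁ e₁
  have i₂ := RegVarTail.isEquivalent_primitive_tilt hfnn₂ hdiv₂ e₂
  have hconv := RegVarTail.isEquivalent_exp_mul_conv_tail hα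
    (RegVarTail.isRegVarNegOne_tilt hfnn₁ hev₁ hrv₁ hdiv₁ e₁)
    (RegVarTail.isRegVarNegOne_tilt hfnn₂ hev₂ hrv₂ hdiv₂ e₂)
  have hsum := RegVarTail.isEquivalent_add
    (by filter_upwards [hdiv₂.eventually_ge_atTop 0] with x hx using mul_nonneg (hfnn₁ x) hx)
    (by filter_upwards [hdiv₁.eventually_ge_atTop 0] with x hx using mul_nonneg (hfnn₂ x) hx)
    (e₁.mul i₂) (e₂.mul i₁)
  have hfin := (IsEquivalent.refl (u := fun x => Real.exp (-α * x)) (l := atTop)).mul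
    (hconv.trans ((IsEquivalent.refl (u := fun _ => α)).mul hsum))
  refine (hfin.congr_left (Eventually.of_forall fun x => ?_)).congr_right
    (Eventually.of_forall fun x => ?_)
  · simp only [Pi.mul_apply]
    rw [← mul_assoc, ← Real.exp_add, show -α * x + α * x = 0 by ring, Real.exp_zero, one_mul]
    rfl
  · simp only [Pi.mul_apply]
    ring
end
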